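/- arXiv:2009.04580 — 2 statements merged into one kernel-verified Lean document; each statement's English description precedes it below -/
import Mathlib

section
/- Assume f satisfies (f1), (f2) and (f3), let 0 < a < b < ∞, and let u₁ and u₂ be two positive solutions of (R) with 0 < u₁'(a) < u₂'(a). Suppose r̄₁(M₁) < r̄₂(M₁) and that r̄₁ and r̄₂ intersect in [β, M₁); let s_I ∈ [β, M₁) be the largest point with r̄₁(s_I) = r̄₂(s_I). Then r̄₁(s)^{n−1}·u₁'(r̄₁(s)) > r̄₂(s)^{n−1}·u₂'(r̄₂(s)) for all s ∈ [s_I, M₁), and P̄₁(s) > P̄₂(s) for all s ∈ [s_I, M₁]. -/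
open Set Filter MeasureTheory

/-- `F(s) = ∫₀ˢ f(t) dt`. -/
noncomputable def Fint (f : ℝ → ℝ) (s : ℝ) : ℝ := ∫ t in (0:ℝ)..s, f t

/-- Condition (f1): `f` is continuous on `[0,∞)`, continuously differentiable on `(0,∞)`,
and `f' ∈ L¹(0,1)`. -/
def CondF1 (f : ℝ → ℝ) : Prop :=
  ContinuousOn f (Ici 0) ∧ (∀ s ∈ Ioi (0:ℝ), DifferentiableAt ℝ f s) ∧
  ContinuousOn (deriv f) (Ioi 0) ∧ IntervalIntegrable (deriv f) volume 0 1

/-- Condition (f2) in the case `β > B > 0`. -/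
def CondF2B (f : ℝ → ℝ) (β B : ℝ) : Prop :=
  f 0 = 0 ∧ 0 < B ∧ B < β ∧ (∀ s, B < s → 0 < f s) ∧
  (∀ s ∈ Icc (0:ℝ) B, f s ≤ 0) ∧ (∃ ε > (0:ℝ), ∀ s ∈ Ioo (0:ℝ) ε, f s < 0) ∧
  Fint f β = 0

/-- Condition (f2): either `β = B = 0` and `f > 0` on `(0,∞)`, or `β > B > 0` with the
sign conditions and `F(β) = 0`. -/
def CondF2 (f : ℝ → ℝ) (β B : ℝ) : Prop :=
  (β = 0 ∧ B = 0 ∧ f 0 = 0 ∧ ∀ s, 0 < s → 0 < f s) ∨ CondF2B f β B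

/-- Condition (f3): the derivative of `s ↦ F(s)/f(s)` is `≥ (n-2)/(2n)` for every `s > β`. -/
def CondF3 (n : ℕ) (f : ℝ → ℝ) (β : ℝ) : Prop :=
  ∀ s, β < s → ∃ d, ((n : ℝ) - 2) / (2 * (n : ℝ)) ≤ d ∧
    HasDerivAt (fun t => Fint f t / f t) d s

/-- Condition (f4): superlinearity `f(s) ≤ f'(s)(s - B)` for `s > B`, with
`f(s) ≢ f'(s)(s - B)` on `[B, β]`. -/
def CondF4 (f : ℝ → ℝ) (β B : ℝ) : Prop :=
  (∀ s, B < s → f s ≤ deriv f s * (s - B)) ∧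
  ¬ (∀ s ∈ Icc B β, f s = deriv f s * (s - B))

/-- A positive solution of problem (R) on the annulus `a < |x| < b`:
`u` is continuous on `[a,b]`, differentiable up to the boundary with derivative `u'`
(one-sided at the endpoints), `u'` is continuous on `[a,b]`, `u` is twice continuously
differentiable on `(a,b)` where it satisfies `u'' + ((n-1)/r) u' + f(u) = 0`,
`u(a) = u(b) = 0` and `u > 0` on `(a,b)`. -/
def IsPosSolAnn (n : ℕ) (a b : ℝ) (f u u' : ℝ → ℝ) : Prop :=
  ContinuousOn u (Icc a b) ∧
  (∀ r ∈ Icc a b, HasDerivWithinAt u (u' r) (Icc a b) r) ∧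
  ContinuousOn u' (Icc a b) ∧
  (∀ r ∈ Ioo a b, HasDerivAt u (u' r) r) ∧
  (∀ r ∈ Ioo a b, HasDerivAt u' (-(((n : ℝ) - 1) / r * u' r + f (u r))) r) ∧
  u a = 0 ∧ u b = 0 ∧ (∀ r ∈ Ioo a b, 0 < u r)

/-- A positive solution of the exterior problem (R) with `b = ∞`:
`u` is continuous on `[a,∞)`, differentiable on `[a,∞)` with derivative `u'`
(one-sided at `a`), twice continuously differentiable on `(a,∞)` where it satisfies
`u'' + ((n-1)/r) u' + f(u) = 0`, `u(a) = 0`, `u > 0` on `(a,∞)` and `u(r) → 0` as `r → ∞`. -/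
def IsPosSolExt (n : ℕ) (a : ℝ) (f u u' : ℝ → ℝ) : Prop :=
  ContinuousOn u (Ici a) ∧
  (∀ r ∈ Ici a, HasDerivWithinAt u (u' r) (Ici a) r) ∧
  (∀ r ∈ Ioi a, HasDerivAt u (u' r) r) ∧
  (∀ r ∈ Ioi a, HasDerivAt u' (-(((n : ℝ) - 1) / r * u' r + f (u r))) r) ∧
  u a = 0 ∧ (∀ r ∈ Ioi a, 0 < u r) ∧
  Tendsto u atTop (nhds 0)

/-- The Erbe–Tang functional
`P(s) = -2n (F(s)/f(s)) ρ(s)^{n-1} u'(ρ(s)) - ρ(s)^n (u'(ρ(s)))² - 2 ρ(s)^n F(s)`,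
where `ρ` is an inverse branch of the solution `u` with derivative `u'`. -/
noncomputable def Pfun (n : ℕ) (f : ℝ → ℝ) (ρ u' : ℝ → ℝ) (s : ℝ) : ℝ :=
  -2 * (n : ℝ) * (Fint f s / f s) * (ρ s) ^ (n - 1) * u' (ρ s)
    - (ρ s) ^ n * (u' (ρ s)) ^ 2 - 2 * (ρ s) ^ n * Fint f s


structure Br (n : ℕ) (f : ℝ → ℝ) (M : ℝ) (ρ u' : ℝ → ℝ) : Prop where
  pos : ∀ s ∈ Icc (0:ℝ) M, 0 < ρ s
  cρ : ContinuousOn ρ (Icc 0 M)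
  cp : ContinuousOn (fun s => u' (ρ s)) (Icc 0 M)
  dρ : ∀ s ∈ Ioo (0:ℝ) M, HasDerivAt ρ (u' (ρ s))⁻¹ s
  dp : ∀ s ∈ Ioo (0:ℝ) M, HasDerivAt (fun s => u' (ρ s))
    (-(((n : ℝ) - 1) / ρ s * u' (ρ s) + f s) * (u' (ρ s))⁻¹) s
  ne : ∀ s ∈ Ioo (0:ℝ) M, u' (ρ s) ≠ 0
  top : u' (ρ M) = 0

lemma inv_cont {u ρ : ℝ → ℝ} {l h M : ℝ} (hu : ContinuousOn u (Icc l h))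
    (inj : InjOn u (Icc l h)) (hρ : ∀ s ∈ Icc (0:ℝ) M, ρ s ∈ Icc l h ∧ u (ρ s) = s) :
    ContinuousOn ρ (Icc 0 M) := by
  intro s hs
  refine isCompact_Icc.tendsto_nhds_of_unique_mapClusterPt
    (eventually_of_mem self_mem_nhdsWithin fun t ht => (hρ t ht).1) ?_
  intro y hy hcl
  apply inj hy (hρ s hs).1
  rw [(hρ s hs).2]
  -- u y is a cluster point of u ∘ ρ = id
  by_contra hne
  have hcu : Tendsto u (nhdsWithin y (Icc l h)) (nhds (u y)) := hu y hy
  obtain ⟨U, V, hU, hV, hyU, hsV, hd⟩ := t2_separation hne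
  have h1 : ∀ᶠ x in nhds y, x ∈ Icc l h → u x ∈ U :=
    eventually_nhdsWithin_iff.1 (hcu.eventually (hU.mem_nhds hyU))
  have h2 : ∃ᶠ t in nhdsWithin s (Icc 0 M), (ρ t ∈ Icc l h → u (ρ t) ∈ U) :=
    (mapClusterPt_iff_frequently.1 hcl) {x | x ∈ Icc l h → u x ∈ U} h1
  have h3 : ∀ᶠ t in nhdsWithin s (Icc 0 M), t ∈ V :=
    mem_nhdsWithin_of_mem_nhds (hV.mem_nhds hsV)
  have h4 : ∀ᶠ t in nhdsWithin s (Icc 0 M), t ∈ Icc 0 M := self_mem_nhdsWithin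
  obtain ⟨t, ht1, ht2, ht3⟩ := (h2.and_eventually (h3.and h4)).exists
  have h5 := ht1 (hρ t ht3).1
  rw [(hρ t ht3).2] at h5
  exact Set.disjoint_left.1 hd h5 ht2

lemma mk_br {n : ℕ} {f u u' ρ : ℝ → ℝ} {a b l h M : ℝ} (ha : 0 < a)
    (hs : IsPosSolAnn n a b f u u') (hl : a ≤ l) (hh : h ≤ b)
    (inj : InjOn u (Icc l h)) (hρ : ∀ s ∈ Icc (0:ℝ) M, ρ s ∈ Icc l h ∧ u (ρ s) = s)
    (hul : u l = 0 ∨ u l = M) (huh : u h = 0 ∨ u h = M)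
    (hne : ∀ r ∈ Ioo l h, u' r ≠ 0) (htop : u' (ρ M) = 0) : Br n f M ρ u' := by
  obtain ⟨cu, -, cu', du, ddu, -⟩ := hs
  have sub : Icc l h ⊆ Icc a b := Icc_subset_Icc hl hh
  have cρ : ContinuousOn ρ (Icc 0 M) := inv_cont (cu.mono sub) inj hρ
  have hin : ∀ s ∈ Ioo (0:ℝ) M, ρ s ∈ Ioo l h := by
    intro s hs
    obtain ⟨⟨h1, h2⟩, h3⟩ := hρ s ⟨hs.1.le, hs.2.le⟩
    refine ⟨lt_of_le_of_ne h1 ?_, lt_of_le_of_ne h2 ?_⟩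
    · intro h; rw [← h] at h3
      rcases hul with h4 | h4 <;> linarith [hs.1, hs.2]
    · intro h; rw [h] at h3
      rcases huh with h4 | h4 <;> linarith [hs.1, hs.2]
  have dρ : ∀ s ∈ Ioo (0:ℝ) M, HasDerivAt ρ (u' (ρ s))⁻¹ s := by
    intro s hs
    have h1 := hin s hs
    refine HasDerivAt.of_local_left_inverse
      (cρ.continuousAt (Icc_mem_nhds hs.1 hs.2)) (du (ρ s) ⟨hl.trans_lt h1.1, h1.2.trans_le hh⟩)
      (hne _ h1) ?_
    filter_upwards [Icc_mem_nhds hs.1 hs.2] with t ht using (hρ t ht).2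
  refine ⟨fun s hs => by linarith [(hρ s hs).1.1], cρ,
    cu'.comp cρ (fun s hs => sub (hρ s hs).1), dρ, ?_, fun s hs => hne _ (hin s hs), htop⟩
  intro s hs
  have h1 := hin s hs
  have h2 := ddu (ρ s) ⟨hl.trans_lt h1.1, h1.2.trans_le hh⟩
  have h3 := h2.comp s (dρ s hs)
  rwa [(hρ s ⟨hs.1.le, hs.2.le⟩).2] at h3

lemma cont_ind {φ : ℝ → ℝ} {x y : ℝ} (hc : ContinuousOn φ (Icc x y)) (h0 : 0 < φ x)
    (hstep : ∀ t ∈ Ioc x y, (∀ s ∈ Ico x t, 0 < φ s) → 0 < φ t) :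
    ∀ s ∈ Icc x y, 0 < φ s := by
  by_contra hcon
  push Not at hcon
  obtain ⟨s, hs, hφ⟩ := hcon
  have hcl : IsCompact (Icc x y ∩ φ ⁻¹' Iic 0) :=
    isCompact_Icc.of_isClosed_subset (hc.preimage_isClosed_of_isClosed isClosed_Icc isClosed_Iic)
      inter_subset_left
  obtain ⟨t, ⟨ht, ht0⟩, hmin⟩ := hcl.exists_isLeast ⟨s, hs, hφ⟩
  have htx : x < t := by
    rcases ht.1.lt_or_eq with h | h
    · exact h
    · rw [← h] at ht0; exact absurd h0 (not_lt.2 ht0)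
  refine absurd (hstep t ⟨htx, ht.2⟩ ?_) (not_lt.2 ht0)
  intro s hs
  by_contra hneg
  have := hmin (show s ∈ Icc x y ∩ φ ⁻¹' Iic 0 from ⟨⟨hs.1, hs.2.le.trans ht.2⟩, not_lt.1 hneg⟩)
  linarith [hs.2]

lemma F_deriv {f : ℝ → ℝ} (hf : ContinuousOn f (Ici 0)) {s : ℝ} (hs : 0 < s) :
    HasDerivAt (Fint f) (f s) s := by
  have h1 : ContinuousOn f (Ioi 0) := hf.mono Ioi_subset_Ici_self
  refine intervalIntegral.integral_hasDerivAt_right ?_ ?_ ?_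
  · exact (hf.mono (by rw [uIcc_of_le hs.le]; exact Icc_subset_Ici_self)).intervalIntegrable
  · exact h1.stronglyMeasurableAtFilter isOpen_Ioi s hs
  · exact h1.continuousAt (Ioi_mem_nhds hs)

lemma F_cont {f : ℝ → ℝ} (hf : ContinuousOn f (Ici 0)) (M : ℝ) (hM : 0 ≤ M) :
    ContinuousOn (Fint f) (Icc 0 M) := by
  have := intervalIntegral.continuousOn_primitive_interval (f := f) (a := 0) (b := M) (μ := volume) ?_
  · rwa [uIcc_of_le hM] at this
  · rw [uIcc_of_le hM]
    exact (hf.mono Icc_subset_Ici_self).integrableOn_compact isCompact_Icc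

lemma anti_of {φ φ' : ℝ → ℝ} {x y : ℝ} (hxy : x ≤ y) (hc : ContinuousOn φ (Icc x y))
    (hd : ∀ s ∈ Ioo x y, HasDerivAt φ (φ' s) s) (hs : ∀ s ∈ Ioo x y, φ' s ≤ 0) : φ y ≤ φ x := by
  have : AntitoneOn φ (Icc x y) := by
    apply antitoneOn_of_deriv_nonpos (convex_Icc x y) hc
    · rw [interior_Icc]; exact fun s h => (hd s h).differentiableAt.differentiableWithinAt
    · rw [interior_Icc]; intro s h; rw [(hd s h).deriv]; exact hs s h
  exact this (left_mem_Icc.2 hxy) (right_mem_Icc.2 hxy) hxy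

lemma santi_of {φ φ' : ℝ → ℝ} {x y : ℝ} (hxy : x < y) (hc : ContinuousOn φ (Icc x y))
    (hd : ∀ s ∈ Ioo x y, HasDerivAt φ (φ' s) s) (hs : ∀ s ∈ Ioo x y, φ' s < 0) : φ y < φ x := by
  have : StrictAntiOn φ (Icc x y) := by
    apply strictAntiOn_of_deriv_neg (convex_Icc x y) hc
    · rw [interior_Icc]; intro s h; rw [(hd s h).deriv]; exact hs s h
  exact this (left_mem_Icc.2 hxy.le) (right_mem_Icc.2 hxy.le) hxy

/-- q² derivative -/
lemma Br.dq {k : ℕ} {f ρ u' : ℝ → ℝ} {M : ℝ} (h : Br (k+2) f M ρ u') :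
    ∀ s ∈ Ioo (0:ℝ) M, HasDerivAt (fun s => ((ρ s)^(k+1) * u' (ρ s))^2)
      (-2 * (ρ s)^(2*k+2) * f s) s := by
  intro s hs
  have h1 := (((h.dρ s hs).pow (k+1)).mul (h.dp s hs)).pow 2
  refine h1.congr_deriv ?_
  have hp := h.ne s hs
  have hr := (h.pos s ⟨hs.1.le, hs.2.le⟩).ne'
  simp only [Pi.mul_apply, Pi.pow_apply]
  push_cast
  field_simp
  ring

lemma Br.dz {k : ℕ} {f ρ u' : ℝ → ℝ} {M : ℝ} (h : Br (k+2) f M ρ u')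
    (hf : ContinuousOn f (Ici 0)) :
    ∀ s ∈ Ioo (0:ℝ) M, HasDerivAt
      (fun s => ((ρ s)^(k+1) * u' (ρ s))^2 + 2 * (ρ s)^(2*k+2) * Fint f s)
      (2 * (2*k+2) * Fint f s * ((ρ s)^(2*k+1) * (u' (ρ s))⁻¹)) s := by
  intro s hs
  have h1 := (h.dq s hs).add ((((h.dρ s hs).pow (2*k+2)).const_mul 2).mul (F_deriv hf hs.1))
  refine h1.congr_deriv ?_
  simp only [Pi.pow_apply]
  push_cast
  simp
  ring

lemma Br.dP {k : ℕ} {f ρ u' : ℝ → ℝ} {M : ℝ} (h : Br (k+2) f M ρ u')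
    (hf : ContinuousOn f (Ici 0)) {s d : ℝ} (hs : s ∈ Ioo (0:ℝ) M) (hfs : 0 < f s)
    (hd : HasDerivAt (fun t => Fint f t / f t) d s) :
    HasDerivAt (Pfun (k+2) f ρ u')
      (-((ρ s)^(k+1) * u' (ρ s)) * (2 * (k+2) * d - k)) s := by
  have h1 := (((hd.const_mul (-2 * ((k+2:ℕ) : ℝ))).mul ((h.dρ s hs).pow (k+1))).mul (h.dp s hs))
  have h2 := ((h.dρ s hs).pow (k+2)).mul ((h.dp s hs).pow 2)
  have h3 := (((h.dρ s hs).pow (k+2)).const_mul 2).mul (F_deriv hf hs.1)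
  have h4 := (h1.sub h2).sub h3
  refine (h4.congr_deriv ?_)
  have hp := h.ne s hs
  have hr := (h.pos s ⟨hs.1.le, hs.2.le⟩).ne'
  simp only [Pi.mul_apply, Pi.pow_apply]
  push_cast
  field_simp
  ring

lemma Br.cP {k : ℕ} {f ρ u' : ℝ → ℝ} {M β x y : ℝ} (h : Br (k+2) f M ρ u')
    (hf : ContinuousOn f (Ici 0)) (hf3 : CondF3 (k+2) f β) (h0 : 0 ≤ x) (hx : β < x) (hy : y ≤ M) :
    ContinuousOn (Pfun (k+2) f ρ u') (Icc x y) := by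
  rcases lt_or_ge y x with hxy | hxy
  · rw [Icc_eq_empty (not_le.2 hxy)]; exact continuousOn_empty _
  have sub : Icc x y ⊆ Icc 0 M := Icc_subset_Icc h0 hy
  have c1 := h.cρ.mono sub
  have c2 := h.cp.mono sub
  have c3 := (F_cont hf M (by linarith)).mono sub
  have c4 : ContinuousOn (fun t => Fint f t / f t) (Icc x y) := by
    intro s hs
    obtain ⟨d, -, hd⟩ := hf3 s (hx.trans_le hs.1)
    exact hd.continuousAt.continuousWithinAt
  exact ((((continuousOn_const.mul c4).mul (c1.pow _)).mul c2).sub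
    ((c1.pow _).mul (c2.pow 2))).sub ((continuousOn_const.mul (c1.pow _)).mul c3)

lemma evpos {g : ℝ → ℝ} {x m : ℝ} (hc : ContinuousOn g (Icc 0 m)) (h0 : 0 ≤ x) (hm : x < m)
    (hg : 0 < g x) : ∀ᶠ y in nhdsWithin x (Ioi x), 0 < g y := by
  have h1 : Tendsto g (nhdsWithin x (Ioi x)) (nhds (g x)) := by
    have h2 : ContinuousWithinAt g (Icc x m) x := (hc x ⟨h0, hm.le⟩).mono (Icc_subset_Icc h0 le_rfl)
    have h3 : ContinuousWithinAt g (Ioc x m) x := h2.mono Ioc_subset_Icc_self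
    have h4 := h3.tendsto
    rwa [nhdsWithin_Ioc_eq_nhdsGT hm] at h4
  exact h1.eventually (lt_mem_nhds hg)

lemma start {n : ℕ} {f ρ₁ ρ₂ u₁' u₂' : ℝ → ℝ} {M₁ M₂ x m : ℝ}
    (b₁ : Br n f M₁ ρ₁ u₁') (b₂ : Br n f M₂ ρ₂ u₂') (h1 : m ≤ M₁) (h2 : m ≤ M₂)
    (hp₁ : ∀ s ∈ Ico 0 M₁, 0 < u₁' (ρ₁ s))
    (h0 : 0 ≤ x) (hm : x < m) (hρ : ρ₂ x ≤ ρ₁ x) (hp : u₁' (ρ₁ x) < u₂' (ρ₂ x)) :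
    ∀ᶠ y in nhdsWithin x (Ioi x), 0 < ρ₁ y - ρ₂ y := by
  have s1 : Icc 0 m ⊆ Icc 0 M₁ := Icc_subset_Icc le_rfl h1
  have s2 : Icc 0 m ⊆ Icc 0 M₂ := Icc_subset_Icc le_rfl h2
  have e1 := evpos (g := fun s => u₂' (ρ₂ s) - u₁' (ρ₁ s))
    ((b₂.cp.mono s2).sub (b₁.cp.mono s1)) h0 hm (sub_pos.2 hp)
  have e2 : ∀ᶠ y in nhdsWithin x (Ioi x), y < m := mem_nhdsWithin_of_mem_nhds (Iio_mem_nhds hm)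
  obtain ⟨y0, hy0, hy⟩ := (mem_nhdsGT_iff_exists_Ioo_subset).1 (e1.and e2)
  filter_upwards [Ioo_mem_nhdsGT hy0] with y hyy
  have hym : y < m := (hy hyy).2
  have key := santi_of (φ := fun s => ρ₂ s - ρ₁ s) hyy.1
    (((b₂.cρ.mono s2).sub (b₁.cρ.mono s1)).mono (Icc_subset_Icc h0 hym.le))
    (fun s hs => (b₂.dρ s ⟨h0.trans_lt hs.1, by linarith [hs.2]⟩).sub
      (b₁.dρ s ⟨h0.trans_lt hs.1, by linarith [hs.2]⟩)) ?_
  · linarith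
  · intro s hs
    have h3 : 0 < u₂' (ρ₂ s) - u₁' (ρ₁ s) := (hy ⟨hs.1, hs.2.trans hyy.2⟩).1
    have h4 := hp₁ s ⟨h0.trans hs.1.le, by linarith [hs.2]⟩
    have := inv_strictAnti₀ h4 (sub_pos.1 h3)
    linarith

lemma phase {n : ℕ} {f ρ₁ ρ₂ u₁' u₂' ψ ψ' : ℝ → ℝ} {M₁ M₂ x e : ℝ}
    (b₁ : Br n f M₁ ρ₁ u₁') (b₂ : Br n f M₂ ρ₂ u₂') (h1 : e ≤ M₁) (h2 : e ≤ M₂)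
    (hp₁ : ∀ s ∈ Ico 0 M₁, 0 < u₁' (ρ₁ s))
    (h0 : 0 ≤ x) (hxe : x ≤ e) (hρ : ρ₂ x < ρ₁ x) (hψ : 0 < ψ x)
    (cψ : ContinuousOn ψ (Icc x e)) (dψ : ∀ s ∈ Ioo x e, HasDerivAt ψ (ψ' s) s)
    (hpp : ∀ s ∈ Ioo x e, ρ₂ s < ρ₁ s → 0 < ψ s → u₁' (ρ₁ s) < u₂' (ρ₂ s))
    (hψ' : ∀ s ∈ Ioo x e, ρ₂ s < ρ₁ s → 0 < ψ s → 0 ≤ ψ' s) :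
    ∀ s ∈ Icc x e, ρ₂ s < ρ₁ s ∧ 0 < ψ s := by
  have s1 : Icc x e ⊆ Icc 0 M₁ := Icc_subset_Icc h0 h1
  have s2 : Icc x e ⊆ Icc 0 M₂ := Icc_subset_Icc h0 h2
  have cr := (b₂.cρ.mono s2).sub (b₁.cρ.mono s1)
  have := cont_ind (φ := fun s => min (ρ₁ s - ρ₂ s) (ψ s)) (x := x) (y := e)
    (continuous_min.comp_continuousOn (((b₁.cρ.mono s1).sub (b₂.cρ.mono s2)).prodMk cψ)) (lt_min (sub_pos.2 hρ) hψ) ?_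
  · intro s hs
    have := lt_min_iff.1 (this s hs)
    exact ⟨sub_pos.1 this.1, this.2⟩
  intro t ht hall
  have hall' : ∀ s ∈ Ioo x t, ρ₂ s < ρ₁ s ∧ 0 < ψ s := fun s hs => by
    have := lt_min_iff.1 (hall s ⟨hs.1.le, hs.2⟩)
    exact ⟨sub_pos.1 this.1, this.2⟩
  have mem : ∀ s ∈ Ioo x t, s ∈ Ioo x e := fun s hs => ⟨hs.1, hs.2.trans_le ht.2⟩
  have sub : Icc x t ⊆ Icc x e := Icc_subset_Icc le_rfl ht.2
  refine lt_min ?_ ?_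
  · have key := anti_of (φ := fun s => ρ₂ s - ρ₁ s) ht.1.le (cr.mono sub)
      (fun s hs => (b₂.dρ s ⟨h0.trans_lt hs.1, by linarith [hs.2, ht.2]⟩).sub
        (b₁.dρ s ⟨h0.trans_lt hs.1, by linarith [hs.2, ht.2]⟩)) ?_
    · linarith
    · intro s hs
      have h3 := hpp s (mem s hs) (hall' s hs).1 (hall' s hs).2
      have h4 := hp₁ s ⟨h0.trans hs.1.le, by linarith [hs.2, ht.2]⟩
      have := inv_strictAnti₀ h4 h3
      linarith
  · have key := anti_of (φ := fun s => - ψ s) ht.1.le (cψ.mono sub).neg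
      (fun s hs => (dψ s (mem s hs)).neg)
      (fun s hs => neg_nonpos.2 (hψ' s (mem s hs) (hall' s hs).1 (hall' s hs).2))
    linarith

lemma p_of_q {k : ℕ} {r₁ r₂ p₁ p₂ : ℝ} (hr : 0 < r₂) (h : r₂ ≤ r₁) (hp₁ : 0 ≤ p₁) (hp₂ : 0 ≤ p₂)
    (hq : 0 < (r₂^(k+1) * p₂)^2 - (r₁^(k+1)*p₁)^2) : p₁ < p₂ := by
  by_contra hcon
  push Not at hcon
  have hr1 : 0 < r₁ := hr.trans_le h
  have h1 : r₂^(k+1) * p₂ ≤ r₁^(k+1)*p₁ := by gcongr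
  have h2 : (r₂^(k+1) * p₂)^2 ≤ (r₁^(k+1)*p₁)^2 := by gcongr
  linarith

lemma p_of_z {k : ℕ} {r₁ r₂ p₁ p₂ F : ℝ} (hr : 0 < r₂) (h : r₂ ≤ r₁) (hp₂ : 0 ≤ p₂)
    (hE : 0 < p₁^2/2 + F)
    (hq : 0 < ((r₂^(k+1) * p₂)^2 + 2*r₂^(2*k+2)*F) - ((r₁^(k+1)*p₁)^2 + 2*r₁^(2*k+2)*F)) :
    p₁ < p₂ := by
  by_contra hcon
  push Not at hcon
  have e1 : ∀ r p : ℝ, (r^(k+1)*p)^2 + 2*r^(2*k+2)*F = 2 * r^(2*k+2) * (p^2/2+F) := by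
    intro r p; ring
  rw [e1, e1] at hq
  have h1 : r₂^(2*k+2) ≤ r₁^(2*k+2) := by gcongr
  have h2 : p₂^2 ≤ p₁^2 := by gcongr
  have h3 : 0 < r₂^(2*k+2) := by positivity
  nlinarith [mul_le_mul_of_nonneg_left (show p₂^2/2+F ≤ p₁^2/2+F by linarith) h3.le,
    mul_le_mul_of_nonneg_right h1 hE.le]

lemma Br.cQ {n k : ℕ} {f ρ u' : ℝ → ℝ} {M : ℝ} (h : Br n f M ρ u') :
    ContinuousOn (fun s => ((ρ s)^(k+1) * u' (ρ s))^2) (Icc 0 M) :=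
  ((h.cρ.pow _).mul h.cp).pow 2

lemma Br.cZ {n k : ℕ} {f ρ u' : ℝ → ℝ} {M : ℝ} (h : Br n f M ρ u') (hM : 0 ≤ M)
    (hf : ContinuousOn f (Ici 0)) :
    ContinuousOn (fun s => ((ρ s)^(k+1) * u' (ρ s))^2 + 2 * (ρ s)^(2*k+2) * Fint f s) (Icc 0 M) :=
  h.cQ.add ((continuousOn_const.mul (h.cρ.pow _)).mul (F_cont hf M hM))

lemma at_beta {k : ℕ} {f ρ₁ ρ₂ u₁' u₂' : ℝ → ℝ} {M₁ M₂ β : ℝ}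
    (hf : ContinuousOn f (Ici 0))
    (b₁ : Br (k+2) f M₁ ρ₁ u₁') (b₂ : Br (k+2) f M₂ ρ₂ u₂') (h1 : β < M₁) (h2 : β < M₂)
    (hp₁ : ∀ s ∈ Ico 0 M₁, 0 < u₁' (ρ₁ s)) (hp₂ : ∀ s ∈ Ico 0 M₂, 0 < u₂' (ρ₂ s))
    (hE₁ : ∀ s ∈ Icc 0 M₁, 0 < (u₁' (ρ₁ s))^2/2 + Fint f s)
    (hβ : 0 ≤ β) (hF : ∀ s ∈ Icc 0 β, Fint f s ≤ 0) (hFβ : Fint f β = 0)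
    (h0 : ρ₁ 0 = ρ₂ 0) (hp : u₁' (ρ₁ 0) < u₂' (ρ₂ 0)) :
    ρ₂ β ≤ ρ₁ β ∧ 0 < ((ρ₂ β)^(k+1) * u₂' (ρ₂ β))^2 - ((ρ₁ β)^(k+1) * u₁' (ρ₁ β))^2 := by
  have hp10 := hp₁ 0 ⟨le_rfl, by linarith⟩
  have hr0 := b₂.pos 0 ⟨le_rfl, by linarith⟩
  have hq0 : 0 < ((ρ₂ 0)^(k+1) * u₂' (ρ₂ 0))^2 - ((ρ₁ 0)^(k+1) * u₁' (ρ₁ 0))^2 := by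
    rw [sub_pos, h0]
    rw [h0] at hp hp10
    gcongr
  rcases hβ.eq_or_lt with h | hβ
  · rw [← h]; exact ⟨h0.ge, hq0⟩
  have s1 : Icc 0 β ⊆ Icc 0 M₁ := Icc_subset_Icc le_rfl h1.le
  have s2 : Icc 0 β ⊆ Icc 0 M₂ := Icc_subset_Icc le_rfl h2.le
  have cψ := ((b₂.cZ (k := k) (by linarith) hf).mono s2).sub ((b₁.cZ (k := k) (by linarith) hf).mono s1)
  have F0 : Fint f 0 = 0 := by simp [Fint]
  have e1 := start b₁ b₂ h1.le h2.le hp₁ le_rfl hβ h0.ge hp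
  have e2 := evpos cψ le_rfl hβ (by simpa [F0] using hq0)
  obtain ⟨x, hx1, hx2, hx⟩ := (e1.and (e2.and (Ioo_mem_nhdsGT hβ))).exists
  have key := phase b₁ b₂ h1.le h2.le hp₁ hx.1.le hx.2.le (sub_pos.1 hx1) hx2
    (cψ.mono (Icc_subset_Icc hx.1.le le_rfl))
    (fun s hs => (b₂.dz hf s ⟨hx.1.trans hs.1, hs.2.trans h2⟩).sub
      (b₁.dz hf s ⟨hx.1.trans hs.1, hs.2.trans h1⟩)) ?_ ?_ β ⟨hx.2.le, le_rfl⟩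
  · refine ⟨key.1.le, ?_⟩
    simpa [hFβ] using key.2
  · intro s hs hr hz
    have i0 := hx.1.trans hs.1
    exact p_of_z (k := k) (b₂.pos s ⟨i0.le, (hs.2.trans h2).le⟩) hr.le
      (hp₂ s ⟨i0.le, (hs.2.trans h2)⟩).le (hE₁ s ⟨i0.le, (hs.2.trans h1).le⟩) hz
  · intro s hs hr hz
    have i0 := hx.1.trans hs.1
    have r2 := b₂.pos s ⟨i0.le, (hs.2.trans h2).le⟩
    have hp1 := hp₁ s ⟨i0.le, hs.2.trans h1⟩
    have hp2 := p_of_z (k := k) r2 hr.le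
      (hp₂ s ⟨i0.le, (hs.2.trans h2)⟩).le (hE₁ s ⟨i0.le, (hs.2.trans h1).le⟩) hz
    have r1 := r2.trans hr
    have hp2' := hp1.trans hp2
    have i1 : (ρ₂ s)^(2*k+1) * (u₂' (ρ₂ s))⁻¹ ≤ (ρ₁ s)^(2*k+1) * (u₁' (ρ₁ s))⁻¹ := by
      gcongr
    have i2 := hF s ⟨i0.le, hs.2.le⟩
    have i3 : 2 * (2*(k:ℝ)+2) * Fint f s ≤ 0 := mul_nonpos_of_nonneg_of_nonpos (by positivity) i2
    have := mul_le_mul_of_nonpos_left i1 i3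
    linarith

lemma d_nonneg {k : ℕ} {d : ℝ} (h : (((k+2:ℕ):ℝ) - 2) / (2 * ((k+2:ℕ):ℝ)) ≤ d) :
    0 ≤ 2 * ((k:ℝ)+2) * d - k := by
  rw [div_le_iff₀ (by positivity)] at h
  push_cast at h
  linarith

/-- comparison on the increasing branch up to the top -/
lemma left_cmp {k : ℕ} {f ρ₁ ρ₂ u₁' u₂' : ℝ → ℝ} {M₁ M₂ β : ℝ}
    (hf : ContinuousOn f (Ici 0)) (hf3 : CondF3 (k+2) f β) (hfp : ∀ s, β < s → 0 < f s)
    (b₁ : Br (k+2) f M₁ ρ₁ u₁') (b₂ : Br (k+2) f M₂ ρ₂ u₂') (h1 : β < M₁) (h2 : β < M₂)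
    (hp₁ : ∀ s ∈ Ico 0 M₁, 0 < u₁' (ρ₁ s)) (hp₂ : ∀ s ∈ Ico 0 M₂, 0 < u₂' (ρ₂ s))
    (hE₁ : ∀ s ∈ Icc 0 M₁, 0 < (u₁' (ρ₁ s))^2/2 + Fint f s)
    (hβ : 0 ≤ β) (hF : ∀ s ∈ Icc 0 β, Fint f s ≤ 0) (hFβ : Fint f β = 0)
    (hFp : ∀ s, β < s → 0 ≤ Fint f s)
    (h0 : ρ₁ 0 = ρ₂ 0) (hp : u₁' (ρ₁ 0) < u₂' (ρ₂ 0)) :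
    M₁ < M₂ ∧ Pfun (k+2) f ρ₂ u₂' M₁ < Pfun (k+2) f ρ₁ u₁' M₁ := by
  obtain ⟨hr, hq⟩ := at_beta hf b₁ b₂ h1 h2 hp₁ hp₂ hE₁ hβ hF hFβ h0 hp
  have hm : β < min M₁ M₂ := lt_min h1 h2
  have m1 : min M₁ M₂ ≤ M₁ := min_le_left _ _
  have m2 : min M₁ M₂ ≤ M₂ := min_le_right _ _
  have s1 : Icc 0 (min M₁ M₂) ⊆ Icc 0 M₁ := Icc_subset_Icc le_rfl m1
  have s2 : Icc 0 (min M₁ M₂) ⊆ Icc 0 M₂ := Icc_subset_Icc le_rfl m2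
  have hM1 : 0 ≤ M₁ := by linarith
  have hr2 := b₂.pos β ⟨hβ, h2.le⟩
  have hr1 := b₁.pos β ⟨hβ, h1.le⟩
  have hpβ := p_of_q (k := k) hr2 hr (hp₁ β ⟨hβ, h1⟩).le (hp₂ β ⟨hβ, h2⟩).le hq
  have e1 := start b₁ b₂ m1 m2 hp₁ hβ hm hr hpβ
  have cQ := ((b₂.cQ (k := k)).mono s2).sub ((b₁.cQ (k := k)).mono s1)
  have e2 := evpos cQ hβ hm hq
  have cg : ContinuousOn (fun s => ((ρ₂ s)^(k+2) * (u₂' (ρ₂ s))^2 - (ρ₁ s)^(k+2) * (u₁' (ρ₁ s))^2)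
      + 2 * Fint f s * ((ρ₂ s)^(k+2) - (ρ₁ s)^(k+2))) (Icc 0 (min M₁ M₂)) := by
    have c1 := b₁.cρ.mono s1
    have c2 := b₂.cρ.mono s2
    have c3 := b₁.cp.mono s1
    have c4 := b₂.cp.mono s2
    have c5 := (F_cont hf M₁ hM1).mono s1
    exact (((c2.pow _).mul (c4.pow 2)).sub ((c1.pow _).mul (c3.pow 2))).add
      ((continuousOn_const.mul c5).mul ((c2.pow _).sub (c1.pow _)))
  have e3 := evpos cg hβ hm (by
    rw [hFβ]
    have t1 : (ρ₁ β)^(k+2) * (u₁' (ρ₁ β))^2 * (ρ₂ β)^k ≤ (ρ₁ β)^(k+2) * (u₁' (ρ₁ β))^2 * (ρ₁ β)^k := by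
      gcongr
    have t2 : (ρ₁ β)^(k+2) * (u₁' (ρ₁ β))^2 * (ρ₁ β)^k = ((ρ₁ β)^(k+1) * u₁' (ρ₁ β))^2 := by ring
    have t3 : (ρ₂ β)^(k+2) * (u₂' (ρ₂ β))^2 * (ρ₂ β)^k = ((ρ₂ β)^(k+1) * u₂' (ρ₂ β))^2 := by ring
    have t4 : (ρ₁ β)^(k+2) * (u₁' (ρ₁ β))^2 < (ρ₂ β)^(k+2) * (u₂' (ρ₂ β))^2 := by
      refine lt_of_mul_lt_mul_right (a := (ρ₂ β)^k) ?_ (by positivity)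
      linarith
    linarith)
  obtain ⟨x, hx1, hx2, hx3, hx⟩ := (e1.and (e2.and (e3.and (Ioo_mem_nhdsGT hm)))).exists
  have x0 : 0 < x := hβ.trans_lt hx.1
  have key := phase b₁ b₂ m1 m2 hp₁ x0.le hx.2.le (sub_pos.1 hx1) hx2
    (cQ.mono (Icc_subset_Icc x0.le le_rfl))
    (fun s hs => (b₂.dq s ⟨x0.trans hs.1, hs.2.trans_le m2⟩).sub
      (b₁.dq s ⟨x0.trans hs.1, hs.2.trans_le m1⟩)) ?_ ?_
  rotate_left
  · intro s hs hr hz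
    have i0 := x0.trans hs.1
    exact p_of_q (k := k) (b₂.pos s ⟨i0.le, (hs.2.trans_le m2).le⟩) hr.le
      (hp₁ s ⟨i0.le, (hs.2.trans_le m1)⟩).le (hp₂ s ⟨i0.le, (hs.2.trans_le m2)⟩).le hz
  · intro s hs hr hz
    have i0 := x0.trans hs.1
    have r2 := b₂.pos s ⟨i0.le, (hs.2.trans_le m2).le⟩
    have i1 : (ρ₂ s)^(2*k+2) ≤ (ρ₁ s)^(2*k+2) := by gcongr
    have i2 := hfp s (hx.1.trans hs.1)
    have := mul_le_mul_of_nonneg_right i1 i2.le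
    linarith
  have hMM : M₁ < M₂ := by
    by_contra hcon
    push Not at hcon
    rw [min_eq_right hcon] at key hx
    have h3 : 0 < ((ρ₂ M₂)^(k+1) * u₂' (ρ₂ M₂))^2 - ((ρ₁ M₂)^(k+1) * u₁' (ρ₁ M₂))^2 :=
      (key M₂ ⟨hx.2.le, le_rfl⟩).2
    rw [b₂.top] at h3
    nlinarith [sq_nonneg ((ρ₁ M₂)^(k+1) * u₁' (ρ₁ M₂))]
  refine ⟨hMM, ?_⟩
  rw [min_eq_left hMM.le] at key hx
  have hqq : ∀ s ∈ Ico x M₁, (ρ₁ s)^(k+1) * u₁' (ρ₁ s) < (ρ₂ s)^(k+1) * u₂' (ρ₂ s) := by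
    intro s hs
    have h3 : 0 < ((ρ₂ s)^(k+1) * u₂' (ρ₂ s))^2 - ((ρ₁ s)^(k+1) * u₁' (ρ₁ s))^2 :=
      (key s ⟨hs.1, hs.2.le⟩).2
    have i0 := x0.trans_le hs.1
    have r2 := b₂.pos s ⟨i0.le, (hs.2.trans hMM).le⟩
    have p2 := hp₂ s ⟨i0.le, (hs.2.trans hMM)⟩
    exact lt_of_pow_lt_pow_left₀ 2 (by positivity) (by linarith)
  unfold CondF3 at hf3
  have hf3' := hf3
  choose! d hd1 hd2 using hf3
  have hfin := anti_of (φ := fun s => Pfun (k+2) f ρ₂ u₂' s - Pfun (k+2) f ρ₁ u₁' s) hx.2.le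
    ((b₂.cP hf hf3' x0.le hx.1 hMM.le).sub (b₁.cP hf hf3' x0.le hx.1 le_rfl))
    (fun s hs => (b₂.dP hf ⟨x0.trans hs.1, hs.2.trans hMM⟩ (hfp s (hx.1.trans hs.1))
      (hd2 s (hx.1.trans hs.1))).sub
      (b₁.dP hf ⟨x0.trans hs.1, hs.2⟩ (hfp s (hx.1.trans hs.1))
      (hd2 s (hx.1.trans hs.1)))) ?_
  · have hq1 := hqq x ⟨le_rfl, hx.2⟩
    have hFf : 0 ≤ Fint f x / f x := div_nonneg (hFp x hx.1) (hfp x hx.1).le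
    have hstart : 0 < Pfun (k+2) f ρ₁ u₁' x - Pfun (k+2) f ρ₂ u₂' x := by
      have e : Pfun (k+2) f ρ₁ u₁' x - Pfun (k+2) f ρ₂ u₂' x =
        2 * (k+2) * ((Fint f x / f x) * ((ρ₂ x)^(k+1) * u₂' (ρ₂ x) - (ρ₁ x)^(k+1) * u₁' (ρ₁ x)))
        + (((ρ₂ x)^(k+2) * (u₂' (ρ₂ x))^2 - (ρ₁ x)^(k+2) * (u₁' (ρ₁ x))^2)
          + 2 * Fint f x * ((ρ₂ x)^(k+2) - (ρ₁ x)^(k+2))) := by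
        simp only [Pfun, show k + 2 - 1 = k + 1 from rfl]
        push_cast
        ring
      rw [e]
      have := mul_nonneg hFf (sub_pos.2 hq1).le
      positivity
    linarith
  · intro s hs
    have hq1 := hqq s ⟨hs.1.le, hs.2⟩
    have hdd := d_nonneg (hd1 s (hx.1.trans hs.1))
    nlinarith [mul_nonneg (sub_pos.2 hq1).le hdd]

lemma F_contI {f : ℝ → ℝ} (hf : ContinuousOn f (Ici 0)) : ContinuousOn (Fint f) (Ici 0) := by
  intro s hs
  have hs' : (0:ℝ) ≤ s := hs
  refine (F_cont hf (s+1) (by linarith) s ⟨hs', by linarith⟩).mono_of_mem_nhdsWithin ?_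
  filter_upwards [self_mem_nhdsWithin, mem_nhdsWithin_of_mem_nhds (Iio_mem_nhds (lt_add_one s))]
    with t h1 h2 using ⟨h1, le_of_lt h2⟩

lemma energy {n : ℕ} (hn : 2 ≤ n) {f u u' : ℝ → ℝ} {a b c : ℝ} (ha : 0 < a)
    (hf : ContinuousOn f (Ici 0)) (hs : IsPosSolAnn n a b f u u') (hc : c ∈ Ioo a b)
    (down : ∀ r ∈ Ioo c b, u' r < 0) :
    ∀ r ∈ Icc a c, 0 < (u' r)^2/2 + Fint f (u r) := by
  obtain ⟨cu, -, cu', du, ddu, ua, ub, up⟩ := hs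
  have un : ∀ r ∈ Icc a b, 0 ≤ u r := by
    intro r hr
    rcases hr.1.eq_or_lt with h | h
    · rw [← h, ua]
    rcases hr.2.eq_or_lt with h' | h'
    · rw [h', ub]
    exact (up r ⟨h, h'⟩).le
  have cE : ContinuousOn (fun r => (u' r)^2/2 + Fint f (u r)) (Icc a b) :=
    ((cu'.pow 2).div_const 2).add ((F_contI hf).comp cu un)
  have dE : ∀ r ∈ Ioo a b, HasDerivAt (fun r => (u' r)^2/2 + Fint f (u r))
      (-(((n:ℝ)-1)/r * (u' r)^2)) r := by
    intro r hr
    have h1 := (((ddu r hr).pow 2).div_const 2).add ((F_deriv hf (up r hr)).comp r (du r hr))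
    refine h1.congr_deriv ?_
    simp
    ring
  have hn' : (0:ℝ) < (n:ℝ) - 1 := by
    have : (2:ℝ) ≤ n := by exact_mod_cast hn
    linarith
  have h1 := santi_of (φ := fun r => (u' r)^2/2 + Fint f (u r)) hc.2
    (cE.mono (Icc_subset_Icc hc.1.le le_rfl))
    (fun r hr => dE r ⟨hc.1.trans hr.1, hr.2⟩) (by
      intro r hr
      have r0 : 0 < r := by linarith [hc.1, hr.1]
      have := down r hr
      have : 0 < (u' r)^2 := by have h := this.ne; positivity
      rw [neg_lt_zero]; positivity)
  intro r hr
  have h2 := anti_of (φ := fun r => (u' r)^2/2 + Fint f (u r)) hr.2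
    (cE.mono (Icc_subset_Icc hr.1 hc.2.le))
    (fun t ht => dE t ⟨hr.1.trans_lt ht.1, ht.2.trans hc.2⟩) (by
      intro t ht
      have r0 : 0 < t := by linarith [hr.1, ht.1]
      rw [neg_nonpos]; positivity)
  have F0 : Fint f 0 = 0 := by simp [Fint]
  simp only [ub, F0] at h1
  nlinarith [sq_nonneg (u' b)]

lemma crit {u' : ℝ → ℝ} {a b c : ℝ} (hc : c ∈ Ioo a b) (cu' : ContinuousOn u' (Icc a b))
    (up : ∀ r ∈ Ico a c, 0 < u' r) (down : ∀ r ∈ Ioo c b, u' r < 0) : u' c = 0 ∧ u' b ≤ 0 := by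
  have h1 : ContinuousAt u' c := cu'.continuousAt (Icc_mem_nhds hc.1 hc.2)
  refine ⟨le_antisymm ?_ ?_, ?_⟩
  · refine le_of_tendsto (h1.tendsto.mono_left (nhdsWithin_le_nhds (s := Ioi c))) ?_
    filter_upwards [Ioo_mem_nhdsGT hc.2] with r hr using (down r hr).le
  · refine ge_of_tendsto (h1.tendsto.mono_left (nhdsWithin_le_nhds (s := Iio c))) ?_
    filter_upwards [Ioo_mem_nhdsLT hc.1] with r hr using (up r ⟨hr.1.le, hr.2⟩).le
  · have h2 : ContinuousWithinAt u' (Ioo c b) b :=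
      (cu' b ⟨(hc.1.trans hc.2).le, le_rfl⟩).mono
        (fun r hr => ⟨(hc.1.trans hr.1).le, hr.2.le⟩)
    have h3 := h2.tendsto
    rw [nhdsWithin_Ioo_eq_nhdsLT hc.2] at h3
    refine le_of_tendsto h3 ?_
    filter_upwards [Ioo_mem_nhdsLT hc.2] with r hr using (down r hr).le

lemma left_exists {n : ℕ} (hn : 2 ≤ n) {f u u' : ℝ → ℝ} {a b c : ℝ} (ha : 0 < a)
    (hf : ContinuousOn f (Ici 0)) (hs : IsPosSolAnn n a b f u u') (hc : c ∈ Ioo a b)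
    (up : ∀ r ∈ Ico a c, 0 < u' r) (down : ∀ r ∈ Ioo c b, u' r < 0) :
    ∃ ρ : ℝ → ℝ, Br n f (u c) ρ u' ∧ ρ 0 = a ∧ ρ (u c) = c ∧
      (∀ s ∈ Ico 0 (u c), 0 < u' (ρ s)) ∧
      (∀ s ∈ Icc 0 (u c), 0 < (u' (ρ s))^2/2 + Fint f s) := by
  have hE := energy hn ha hf hs hc down
  have hs' := hs
  obtain ⟨cu, -, cu', du, ddu, ua, ub, upos⟩ := hs
  have mono : StrictMonoOn u (Icc a c) := by
    apply strictMonoOn_of_deriv_pos (convex_Icc a c) (cu.mono (Icc_subset_Icc le_rfl hc.2.le))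
    rw [interior_Icc]; intro r hr
    rw [(du r ⟨hr.1, hr.2.trans hc.2⟩).deriv]
    exact up r ⟨hr.1.le, hr.2⟩
  have iv := intermediate_value_Icc hc.1.le (cu.mono (Icc_subset_Icc le_rfl hc.2.le))
  rw [ua] at iv
  have ex : ∀ s, ∃ r, s ∈ Icc 0 (u c) → r ∈ Icc a c ∧ u r = s := by
    intro s
    by_cases h : s ∈ Icc 0 (u c)
    · obtain ⟨r, hr, hrs⟩ := iv h
      exact ⟨r, fun _ => ⟨hr, hrs⟩⟩
    · exact ⟨0, fun h' => absurd h' h⟩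
  choose ρ hρ using ex
  have hM := upos c hc
  have la : a ∈ Icc a c := ⟨le_rfl, hc.1.le⟩
  have lc : c ∈ Icc a c := ⟨hc.1.le, le_rfl⟩
  have m0 : (0:ℝ) ∈ Icc 0 (u c) := ⟨le_rfl, hM.le⟩
  have mM : u c ∈ Icc 0 (u c) := ⟨hM.le, le_rfl⟩
  have r0 : ρ 0 = a := mono.injOn (hρ 0 m0).1 la (by rw [(hρ 0 m0).2, ua])
  have rM : ρ (u c) = c := mono.injOn (hρ _ mM).1 lc (hρ _ mM).2
  refine ⟨ρ, mk_br ha hs' le_rfl hc.2.le mono.injOn hρ (Or.inl ua) (Or.inr rfl)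
    (fun r hr => (up r ⟨hr.1.le, hr.2⟩).ne') (by rw [rM]; exact (crit hc cu' up down).1),
    r0, rM, ?_, ?_⟩
  · intro s hs
    obtain ⟨h1, h2⟩ := hρ s ⟨hs.1, hs.2.le⟩
    refine up _ ⟨h1.1, lt_of_le_of_ne h1.2 ?_⟩
    intro h
    rw [h] at h2
    linarith [hs.2]
  · intro s hs
    have := hE (ρ s) (hρ s hs).1
    rwa [(hρ s hs).2] at this

lemma right_br {n : ℕ} {f u u' rb : ℝ → ℝ} {a b c : ℝ} (ha : 0 < a)
    (hs : IsPosSolAnn n a b f u u') (hc : c ∈ Ioo a b)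
    (up : ∀ r ∈ Ico a c, 0 < u' r) (down : ∀ r ∈ Ioo c b, u' r < 0)
    (hmem : ∀ s ∈ Icc (0:ℝ) (u c), rb s ∈ Icc c b ∧ u (rb s) = s)
    (hinv : ∀ r ∈ Icc c b, rb (u r) = r) :
    Br n f (u c) rb u' ∧ rb (u c) = c ∧ (∀ s ∈ Icc 0 (u c), u' (rb s) ≤ 0) := by
  have hs' := hs
  obtain ⟨cu, -, cu', du, ddu, ua, ub, upos⟩ := hs
  have inj : InjOn u (Icc c b) := fun x hx y hy h => by rw [← hinv x hx, ← hinv y hy, h]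
  have hcr := crit hc cu' up down
  have rM : rb (u c) = c := hinv c ⟨le_rfl, hc.2.le⟩
  refine ⟨mk_br ha hs' hc.1.le le_rfl inj hmem (Or.inr rfl) (Or.inl ub)
    (fun r hr => (down r hr).ne) (by rw [rM]; exact hcr.1), rM, ?_⟩
  intro s hs
  obtain ⟨h1, h2⟩ := hmem s hs
  rcases h1.1.eq_or_lt with h | h
  · rw [← h, hcr.1]
  rcases h1.2.eq_or_lt with h' | h'
  · rw [h']; exact hcr.2
  exact (down _ ⟨h, h'⟩).le

lemma F_signs {f : ℝ → ℝ} {β B : ℝ} (hf : ContinuousOn f (Ici 0)) (hf2 : CondF2 f β B) :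
    0 ≤ β ∧ (∀ s, β < s → 0 < f s) ∧ Fint f β = 0 ∧ (∀ s ∈ Icc 0 β, Fint f s ≤ 0) ∧
      (∀ s, β < s → 0 ≤ Fint f s) := by
  have F0 : Fint f 0 = 0 := by simp [Fint]
  have hfirst : 0 ≤ β ∧ (∀ s, β < s → 0 < f s) ∧ Fint f β = 0 ∧ (∀ s ∈ Icc 0 β, Fint f s ≤ 0) := by
    rcases hf2 with ⟨rfl, rfl, h0, hp⟩ | ⟨h0, hB, hBβ, hp, hneg, -, hFβ⟩
    · refine ⟨le_rfl, hp, F0, ?_⟩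
      intro s hs
      rw [le_antisymm hs.2 hs.1, F0]
    · refine ⟨(hB.trans hBβ).le, fun s hs => hp s (hBβ.trans hs), hFβ, ?_⟩
      intro s hs
      rcases le_total s B with h | h
      · have := anti_of (φ := Fint f) hs.1 (F_cont hf s hs.1) (fun t ht => F_deriv hf ht.1)
          (fun t ht => hneg t ⟨ht.1.le, ht.2.le.trans h⟩)
        rwa [F0] at this
      · have := anti_of (φ := fun t => - Fint f t) hs.2
          ((F_cont hf β (hB.trans hBβ).le).mono (Icc_subset_Icc hs.1 le_rfl)).neg
          (fun t ht => (F_deriv hf (hs.1.trans_lt ht.1)).neg)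
          (fun t ht => by have := hp t (h.trans_lt ht.1); linarith)
        rw [hFβ] at this
        linarith
  obtain ⟨h1, h2, h3, h4⟩ := hfirst
  refine ⟨h1, h2, h3, h4, ?_⟩
  intro s hs
  have := anti_of (φ := fun t => - Fint f t) hs.le
    ((F_cont hf s (h1.trans hs.le)).mono (Icc_subset_Icc h1 le_rfl)).neg
    (fun t ht => (F_deriv hf (h1.trans_lt ht.1)).neg)
    (fun t ht => by have := h2 t ht.1; linarith)
  rw [h3] at this
  linarith

/-- Step four (Proposition 3.5): if `r̄₁(M₁) < r̄₂(M₁)` and `r̄₁, r̄₂` intersect in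
`[β, M₁)` with largest intersection point `s_I`, then
`r̄₁(s)^{n-1} u₁'(r̄₁(s)) > r̄₂(s)^{n-1} u₂'(r̄₂(s))` on `[s_I, M₁)` and `P̄₁ > P̄₂` on `[s_I, M₁]`. -/
theorem step_four
    (n : ℕ) (hn : 2 ≤ n) (f : ℝ → ℝ) (β B : ℝ)
    (hf1 : CondF1 f) (hf2 : CondF2 f β B) (hf3 : CondF3 n f β)
    (a b : ℝ) (ha : 0 < a) (hab : a < b)
    (u₁ u₁' u₂ u₂' : ℝ → ℝ)
    (h₁ : IsPosSolAnn n a b f u₁ u₁') (h₂ : IsPosSolAnn n a b f u₂ u₂')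
    (hslope₁ : 0 < u₁' a) (hslope₁₂ : u₁' a < u₂' a)
    (c₁ c₂ : ℝ) (hc₁ : c₁ ∈ Ioo a b) (hc₂ : c₂ ∈ Ioo a b)
    (hc₁up : ∀ r ∈ Ico a c₁, 0 < u₁' r) (hc₁down : ∀ r ∈ Ioo c₁ b, u₁' r < 0)
    (hc₂up : ∀ r ∈ Ico a c₂, 0 < u₂' r) (hc₂down : ∀ r ∈ Ioo c₂ b, u₂' r < 0)
    (M₁ M₂ : ℝ) (hM₁ : M₁ = u₁ c₁) (hM₂ : M₂ = u₂ c₂)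
    (rb₁ rb₂ : ℝ → ℝ)
    (hrb₁mem : ∀ s ∈ Icc (0:ℝ) M₁, rb₁ s ∈ Icc c₁ b ∧ u₁ (rb₁ s) = s)
    (hrb₁inv : ∀ r ∈ Icc c₁ b, rb₁ (u₁ r) = r)
    (hrb₂mem : ∀ s ∈ Icc (0:ℝ) M₂, rb₂ s ∈ Icc c₂ b ∧ u₂ (rb₂ s) = s)
    (hrb₂inv : ∀ r ∈ Icc c₂ b, rb₂ (u₂ r) = r)
    (hlt : rb₁ M₁ < rb₂ M₁)
    (sI : ℝ) (hsI : sI ∈ Ico β M₁) (hsIint : rb₁ sI = rb₂ sI)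
    (hsIlargest : ∀ s ∈ Ioo sI M₁, rb₁ s ≠ rb₂ s) :
    (∀ s ∈ Ico sI M₁,
      (rb₂ s) ^ (n - 1) * u₂' (rb₂ s) < (rb₁ s) ^ (n - 1) * u₁' (rb₁ s)) ∧
    (∀ s ∈ Icc sI M₁, Pfun n f rb₂ u₂' s < Pfun n f rb₁ u₁' s) := by
  obtain ⟨k, rfl⟩ : ∃ k, n = k + 2 := ⟨n - 2, by omega⟩
  have hf := hf1.1
  obtain ⟨hβ, hfp, hFβ, hF, hFp⟩ := F_signs hf hf2
  subst hM₁
  subst hM₂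
  obtain ⟨ρ₁, b₁, z₁, t₁, hp₁, hE₁⟩ := left_exists hn ha hf h₁ hc₁ hc₁up hc₁down
  obtain ⟨ρ₂, b₂, z₂, t₂, hp₂, hE₂⟩ := left_exists hn ha hf h₂ hc₂ hc₂up hc₂down
  obtain ⟨d₁, v₁, n₁⟩ := right_br ha h₁ hc₁ hc₁up hc₁down hrb₁mem hrb₁inv
  obtain ⟨d₂, v₂, n₂⟩ := right_br ha h₂ hc₂ hc₂up hc₂down hrb₂mem hrb₂inv
  have hM1 : 0 < u₁ c₁ := h₁.2.2.2.2.2.2.2 c₁ hc₁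
  have hM2 : 0 < u₂ c₂ := h₂.2.2.2.2.2.2.2 c₂ hc₂
  have hβ1 : β < u₁ c₁ := hsI.1.trans_lt hsI.2
  have hβ2 : β < u₂ c₂ := by
    by_contra hcon
    push Not at hcon
    have h3 := hE₂ _ ⟨hM2.le, le_rfl⟩
    rw [b₂.top] at h3
    linarith [hF _ ⟨hM2.le, hcon⟩]
  obtain ⟨hMM, hPl⟩ := left_cmp hf hf3 hfp b₁ b₂ hβ1 hβ2 hp₁ hp₂ hE₁ hβ hF hFβ hFp
    (by rw [z₁, z₂]) (by rw [z₁, z₂]; exact hslope₁₂)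
  unfold CondF3 at hf3
  have hf3' : CondF3 (k+2) f β := hf3
  choose! d hd1 hd2 using hf3
  -- around the top of u₂
  have hPtop : Pfun (k+2) f rb₂ u₂' (u₁ c₁) < Pfun (k+2) f rb₁ u₁' (u₁ c₁) := by
    have e1 : Pfun (k+2) f rb₁ u₁' (u₁ c₁) = Pfun (k+2) f ρ₁ u₁' (u₁ c₁) := by
      simp only [Pfun, v₁, t₁]
    have e2 : Pfun (k+2) f rb₂ u₂' (u₂ c₂) = Pfun (k+2) f ρ₂ u₂' (u₂ c₂) := by
      simp only [Pfun, v₂, t₂]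
    have a1 := anti_of hMM.le (b₂.cP hf hf3' hM1.le hβ1 le_rfl)
      (fun s hs => b₂.dP hf ⟨hM1.trans hs.1, hs.2⟩ (hfp s (hβ1.trans hs.1))
        (hd2 s (hβ1.trans hs.1))) (by
        intro s hs
        have i1 := d_nonneg (hd1 s (hβ1.trans hs.1))
        have i2 := b₂.pos s ⟨(hM1.trans hs.1).le, hs.2.le⟩
        have i3 := hp₂ s ⟨(hM1.trans hs.1).le, hs.2⟩
        have : 0 ≤ (ρ₂ s ^ (k + 1) * u₂' (ρ₂ s)) * (2 * (k + 2) * d s - k) :=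
          mul_nonneg (by positivity) i1
        linarith)
    have a2 := anti_of (φ := fun s => - Pfun (k+2) f rb₂ u₂' s) hMM.le
      (d₂.cP hf hf3' hM1.le hβ1 le_rfl).neg
      (fun s hs => (d₂.dP hf ⟨hM1.trans hs.1, hs.2⟩ (hfp s (hβ1.trans hs.1))
        (hd2 s (hβ1.trans hs.1))).neg) (by
        intro s hs
        have i1 := d_nonneg (hd1 s (hβ1.trans hs.1))
        have i2 := d₂.pos s ⟨(hM1.trans hs.1).le, hs.2.le⟩
        have i3 := n₂ s ⟨(hM1.trans hs.1).le, hs.2.le⟩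
        have : 0 ≤ (rb₂ s ^ (k + 1) * -u₂' (rb₂ s)) * (2 * (k + 2) * d s - k) :=
          mul_nonneg (mul_nonneg (by positivity) (by linarith)) i1
        linarith)
    linarith
  have hsI0 : 0 ≤ sI := hβ.trans hsI.1
  have sub1 : Icc sI (u₁ c₁) ⊆ Icc 0 (u₁ c₁) := Icc_subset_Icc hsI0 le_rfl
  have sub2 : Icc sI (u₁ c₁) ⊆ Icc 0 (u₂ c₂) := Icc_subset_Icc hsI0 hMM.le
  -- ordering
  have hord : ∀ s ∈ Ioo sI (u₁ c₁), rb₁ s < rb₂ s := by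
    intro s hs
    by_contra hcon
    push Not at hcon
    have cc : ContinuousOn (fun t => rb₂ t - rb₁ t) (Icc s (u₁ c₁)) :=
      ((d₂.cρ.mono sub2).sub (d₁.cρ.mono sub1)).mono (Icc_subset_Icc hs.1.le le_rfl)
    obtain ⟨t, ht, ht0⟩ := intermediate_value_Icc hs.2.le cc
      (show (0:ℝ) ∈ Icc _ _ from ⟨by linarith, by linarith⟩)
    simp only at ht0
    have htM : t ≠ u₁ c₁ := by
      rintro rfl
      linarith
    exact hsIlargest t ⟨hs.1.trans_le ht.1, lt_of_le_of_ne ht.2 htM⟩ (by linarith)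
  have hQ : ∀ s ∈ Ico sI (u₁ c₁),
      ((rb₁ s)^(k+1) * u₁' (rb₁ s))^2 < ((rb₂ s)^(k+1) * u₂' (rb₂ s))^2 := by
    intro s hs
    have s0 := hsI0.trans hs.1
    have key := santi_of
      (φ := fun t => ((rb₂ t)^(k+1) * u₂' (rb₂ t))^2 - ((rb₁ t)^(k+1) * u₁' (rb₁ t))^2) hs.2
      (((d₂.cQ.mono sub2).sub (d₁.cQ.mono sub1)).mono (Icc_subset_Icc hs.1 le_rfl))
      (fun t ht => (d₂.dq t ⟨s0.trans_lt ht.1, ht.2.trans hMM⟩).sub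
        (d₁.dq t ⟨s0.trans_lt ht.1, ht.2⟩)) (by
        intro t ht
        have i0 := hord t ⟨hs.1.trans_lt ht.1, ht.2⟩
        have i1 := d₁.pos t ⟨(s0.trans_lt ht.1).le, ht.2.le⟩
        have i2 := hfp t ((hsI.1.trans hs.1).trans_lt ht.1)
        have i3 : (rb₁ t)^(2*k+2) < (rb₂ t)^(2*k+2) := by gcongr
        nlinarith [mul_lt_mul_of_pos_right i3 i2])
    simp only [d₁.top] at key
    nlinarith [sq_nonneg ((rb₂ (u₁ c₁))^(k+1) * u₂' (rb₂ (u₁ c₁)))]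
  have hq : ∀ s ∈ Ico sI (u₁ c₁),
      (rb₂ s)^(k+1) * u₂' (rb₂ s) < (rb₁ s)^(k+1) * u₁' (rb₁ s) := by
    intro s hs
    have i1 := d₂.pos s (sub2 ⟨hs.1, hs.2.le⟩)
    have i2 := n₂ s (sub2 ⟨hs.1, hs.2.le⟩)
    have i3 : 0 ≤ (rb₂ s)^(k+1) * -u₂' (rb₂ s) := mul_nonneg (by positivity) (by linarith)
    have := abs_lt_of_sq_lt_sq (a := (rb₁ s)^(k+1) * u₁' (rb₁ s))
      (b := (rb₂ s)^(k+1) * -u₂' (rb₂ s)) (by have := hQ s hs; nlinarith) i3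
    linarith [(abs_lt.1 this).1]
  refine ⟨hq, ?_⟩
  intro s hs
  rcases (hsI.1.trans hs.1).eq_or_lt with h | hβs
  · -- s = β = sI
    have hsI' : sI = β := le_antisymm (h ▸ hs.1) hsI.1
    subst hsI'
    subst h
    have h1 := hQ sI hsI
    simp only [Pfun, hFβ, show k + 2 - 1 = k + 1 from rfl]
    rw [← hsIint] at h1 ⊢
    have i1 := d₁.pos sI (sub1 hs)
    have h2 : (u₁' (rb₁ sI))^2 < (u₂' (rb₁ sI))^2 := by
      rw [mul_pow, mul_pow] at h1
      exact lt_of_mul_lt_mul_left h1 (by positivity)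
    have h3 : (rb₁ sI)^(k+2) * (u₁' (rb₁ sI))^2 < (rb₁ sI)^(k+2) * (u₂' (rb₁ sI))^2 := by gcongr
    simp only [zero_div, mul_zero, zero_mul]
    linarith
  · have s0 := hβ.trans_lt hβs
    have hfin := anti_of (φ := fun s => Pfun (k+2) f rb₁ u₁' s - Pfun (k+2) f rb₂ u₂' s) hs.2
      ((d₁.cP hf hf3' s0.le hβs le_rfl).sub (d₂.cP hf hf3' s0.le hβs hMM.le))
      (fun t ht => (d₁.dP hf ⟨s0.trans ht.1, ht.2⟩ (hfp t (hβs.trans ht.1))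
        (hd2 t (hβs.trans ht.1))).sub
        (d₂.dP hf ⟨s0.trans ht.1, ht.2.trans hMM⟩ (hfp t (hβs.trans ht.1))
        (hd2 t (hβs.trans ht.1)))) (by
        intro t ht
        have i1 := hq t ⟨hs.1.trans ht.1.le, ht.2⟩
        have i2 := d_nonneg (hd1 t (hβs.trans ht.1))
        nlinarith [mul_nonneg (sub_pos.2 i1).le i2])
    linarith
end

section
/- Assume f satisfies (f1), (f2) and (f3), let 0 < a < b < ∞, and let u₁ and u₂ be two positive solutions of (R) with 0 < u₁'(a) < u₂'(a). If either (i) r̄₁(M₁) < r̄₂(M₁) and r̄₁, r̄₂ intersect in (β, M₁), or (ii) r̄₁(M₁) ≥ r̄₂(M₁), then r̄₁(β) > r̄₂(β) and r̄₁(β)·u₁'(r̄₁(β)) > r̄₂(β)·u₂'(r̄₂(β)) (the latter quantity being r̄ᵢ(β)/r̄ᵢ'(β)). -/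
open Set Filter MeasureTheory

lemma mono_help {g : ℝ → ℝ} {x y : ℝ} (hxy : x ≤ y) (hc : ContinuousOn g (Icc x y))
    (hd : ∀ s ∈ Ioo x y, ∃ d, 0 ≤ d ∧ HasDerivAt g d s) : g x ≤ g y := by
  have : MonotoneOn g (Icc x y) := by
    apply monotoneOn_of_deriv_nonneg (convex_Icc x y) hc
    · intro s hs
      rw [interior_Icc] at hs
      obtain ⟨d, -, h⟩ := hd s hs
      exact h.differentiableAt.differentiableWithinAt
    · intro s hs
      rw [interior_Icc] at hs
      obtain ⟨d, h0, h⟩ := hd s hs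
      rw [h.deriv]; exact h0
  exact this (left_mem_Icc.2 hxy) (right_mem_Icc.2 hxy) hxy

lemma anti_help {g : ℝ → ℝ} {x y : ℝ} (hxy : x ≤ y) (hc : ContinuousOn g (Icc x y))
    (hd : ∀ s ∈ Ioo x y, ∃ d, d ≤ 0 ∧ HasDerivAt g d s) : g y ≤ g x := by
  have := mono_help (g := fun s => - g s) hxy hc.neg (by
    intro s hs
    obtain ⟨d, h0, h⟩ := hd s hs
    exact ⟨-d, by linarith, h.neg⟩)
  simpa using this

lemma smono_help {g : ℝ → ℝ} {x y : ℝ} (hxy : x < y) (hc : ContinuousOn g (Icc x y))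
    (hd : ∀ s ∈ Ioo x y, ∃ d, 0 < d ∧ HasDerivAt g d s) : g x < g y := by
  have : StrictMonoOn g (Icc x y) := by
    apply strictMonoOn_of_deriv_pos (convex_Icc x y) hc
    · intro s hs
      rw [interior_Icc] at hs
      obtain ⟨d, h0, h⟩ := hd s hs
      rw [h.deriv]; exact h0
  exact this (left_mem_Icc.2 hxy.le) (right_mem_Icc.2 hxy.le) hxy

lemma cont_up {D : ℝ → ℝ} {x y : ℝ} (hc : ContinuousOn D (Icc x y)) (h0 : 0 < D x)
    (hs : ∀ s ∈ Ioc x y, (∀ t ∈ Ico x s, 0 < D t) → 0 < D s) : ∀ s ∈ Icc x y, 0 < D s := by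
  by_contra hcon
  push Not at hcon
  obtain ⟨s, hsI, hsD⟩ := hcon
  have hcl : IsClosed (Icc x y ∩ D ⁻¹' Iic 0) := hc.preimage_isClosed_of_isClosed isClosed_Icc isClosed_Iic
  have hcp : IsCompact (Icc x y ∩ D ⁻¹' Iic 0) :=
    isCompact_Icc.of_isClosed_subset hcl inter_subset_left
  obtain ⟨m, ⟨hm1, hm2⟩, hmin⟩ := hcp.exists_isLeast ⟨s, hsI, hsD⟩
  have hm2' : D m ≤ 0 := hm2
  have hne : x ≠ m := by rintro rfl; linarith
  have hlt : x < m := lt_of_le_of_ne hm1.1 hne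
  have := hs m ⟨hlt, hm1.2⟩ (by
    intro t ht
    by_contra hneg
    have := hmin ⟨⟨ht.1, ht.2.le.trans hm1.2⟩, not_lt.1 hneg⟩
    linarith [ht.2])
  linarith

lemma cont_down {D : ℝ → ℝ} {x y : ℝ} (hc : ContinuousOn D (Icc x y)) (h0 : 0 < D y)
    (hs : ∀ s ∈ Ico x y, (∀ t ∈ Ioc s y, 0 < D t) → 0 < D s) : ∀ s ∈ Icc x y, 0 < D s := by
  by_contra hcon
  push Not at hcon
  obtain ⟨s, hsI, hsD⟩ := hcon
  have hcl : IsClosed (Icc x y ∩ D ⁻¹' Iic 0) := hc.preimage_isClosed_of_isClosed isClosed_Icc isClosed_Iic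
  have hcp : IsCompact (Icc x y ∩ D ⁻¹' Iic 0) :=
    isCompact_Icc.of_isClosed_subset hcl inter_subset_left
  obtain ⟨m, ⟨hm1, hm2⟩, hmax⟩ := hcp.exists_isGreatest ⟨s, hsI, hsD⟩
  have hm2' : D m ≤ 0 := hm2
  have hne : m ≠ y := by rintro rfl; linarith
  have hlt : m < y := lt_of_le_of_ne hm1.2 hne
  have := hs m ⟨hm1.1, hlt⟩ (by
    intro t ht
    by_contra hneg
    have := hmax ⟨⟨hm1.1.trans ht.1.le, ht.2⟩, not_lt.1 hneg⟩
    linarith [ht.1])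
  linarith

/-- Branch of a solution parametrised by the height `s`. -/
structure Br_s14 (m : ℕ) (f : ℝ → ℝ) (M : ℝ) (r p : ℝ → ℝ) : Prop where
  hr : ContinuousOn r (Icc 0 M)
  hp : ContinuousOn p (Icc 0 M)
  pos : ∀ s ∈ Icc 0 M, 0 < r s
  ne : ∀ s ∈ Ioo 0 M, p s ≠ 0
  dr : ∀ s ∈ Ioo 0 M, HasDerivAt r (p s)⁻¹ s
  dp : ∀ s ∈ Ioo 0 M, HasDerivAt p (-(((m:ℝ) + 1) / r s * p s + f s) * (p s)⁻¹) s

/-- Facts on the nonlinearity. -/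
structure NL (m : ℕ) (f F G : ℝ → ℝ) (β : ℝ) : Prop where
  b0 : 0 ≤ β
  dF : ∀ s, 0 < s → HasDerivAt F (f s) s
  cF : ContinuousOn F (Ici 0)
  Fneg : ∀ s ∈ Icc 0 β, F s ≤ 0
  Fpos : ∀ s, β < s → 0 < F s
  Fb : F β = 0
  fpos : ∀ s, β < s → 0 < f s
  cG : ContinuousOn G (Ici β)
  Gb : G β = 0
  GF : ∀ s, β < s → G s * f s = F s
  dG : ∀ s, β < s → ∃ d, (m:ℝ) ≤ 2 * ((m:ℝ) + 2) * d ∧ HasDerivAt G d s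

/-- The Erbe-Tang functional. -/
noncomputable def PP (m : ℕ) (F G r p : ℝ → ℝ) (s : ℝ) : ℝ :=
  -2 * ((m:ℝ) + 2) * G s * ((r s) ^ (m+1) * p s) - (r s) ^ (m+2) * (p s)^2
    - 2 * (r s) ^ (m+2) * F s

lemma Br_s14.dW {m : ℕ} {f : ℝ → ℝ} {M : ℝ} {r p : ℝ → ℝ} (h : Br_s14 m f M r p) {s : ℝ}
    (hs : s ∈ Ioo 0 M) :
    HasDerivAt (fun s => (r s)^(m+1) * p s) (-((r s)^(m+1) * f s * (p s)⁻¹)) s := by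
  have h1 := ((h.dr s hs).fun_pow (m+1)).fun_mul (h.dp s hs)
  refine h1.congr_deriv ?_
  have := h.ne s hs
  have := (h.pos s ⟨hs.1.le, hs.2.le⟩).ne'
  push_cast
  field_simp
  ring

lemma Br_s14.dW2 {m : ℕ} {f : ℝ → ℝ} {M : ℝ} {r p : ℝ → ℝ} (h : Br_s14 m f M r p) {s : ℝ}
    (hs : s ∈ Ioo 0 M) :
    HasDerivAt (fun s => ((r s)^(m+1) * p s)^2) (-2 * (((r s)^(m+1))^2 * f s)) s := by
  have h1 := (h.dW hs).fun_pow 2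
  refine h1.congr_deriv ?_
  have := h.ne s hs
  push_cast
  field_simp

lemma Br_s14.dQ {m : ℕ} {f : ℝ → ℝ} {M : ℝ} {r p F : ℝ → ℝ} (h : Br_s14 m f M r p) {s : ℝ}
    (hs : s ∈ Ioo 0 M) (hF : HasDerivAt F (f s) s) :
    HasDerivAt (fun s => ((r s)^(m+1))^2 * ((p s)^2 + 2 * F s))
      (4 * ((m:ℝ)+1) * F s * ((r s)^(2*m+1) * (p s)⁻¹)) s := by
  have h1 := (((h.dr s hs).fun_pow (m+1)).fun_pow 2).fun_mul
    (((h.dp s hs).fun_pow 2).fun_add (hF.const_mul 2))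
  refine h1.congr_deriv ?_
  have := h.ne s hs
  have := (h.pos s ⟨hs.1.le, hs.2.le⟩).ne'
  push_cast
  field_simp
  ring

lemma Br_s14.dlog {m : ℕ} {f : ℝ → ℝ} {M : ℝ} {r p : ℝ → ℝ} (h : Br_s14 m f M r p) {s : ℝ}
    (hs : s ∈ Ioo 0 M) :
    HasDerivAt (fun s => Real.log (r s)) ((r s * p s)⁻¹) s := by
  have h1 := (h.dr s hs).log (h.pos s ⟨hs.1.le, hs.2.le⟩).ne'
  refine h1.congr_deriv ?_
  have := h.ne s hs
  have := (h.pos s ⟨hs.1.le, hs.2.le⟩).ne'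
  field_simp

lemma Br_s14.dP {m : ℕ} {f : ℝ → ℝ} {M : ℝ} {r p F G : ℝ → ℝ} (h : Br_s14 m f M r p) {s d : ℝ}
    (hs : s ∈ Ioo 0 M) (hF : HasDerivAt F (f s) s) (hG : HasDerivAt G d s)
    (hGF : G s * f s = F s) :
    HasDerivAt (PP m F G r p) (((m:ℝ) - 2 * ((m:ℝ)+2) * d) * ((r s)^(m+1) * p s)) s := by
  have h1 := ((((hG.const_mul (-2 * ((m:ℝ)+2))).fun_mul (h.dW hs))).fun_sub
    (((h.dr s hs).fun_pow (m+2)).fun_mul ((h.dp s hs).fun_pow 2))).fun_sub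
    ((((h.dr s hs).fun_pow (m+2)).const_mul 2).fun_mul hF)
  refine (h1.congr_deriv ?_)
  have := h.ne s hs
  have := (h.pos s ⟨hs.1.le, hs.2.le⟩).ne'
  rw [← hGF]
  push_cast
  field_simp
  ring

lemma PP_cont {m : ℕ} {f : ℝ → ℝ} {M β : ℝ} {r p F G : ℝ → ℝ} (h : Br_s14 m f M r p)
    (hN : NL m f F G β) : ContinuousOn (PP m F G r p) (Icc β M) := by
  have hr := h.hr.mono (Icc_subset_Icc_left hN.b0)
  have hp := h.hp.mono (Icc_subset_Icc_left hN.b0)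
  have hG : ContinuousOn G (Icc β M) := hN.cG.mono Icc_subset_Ici_self
  have hF : ContinuousOn F (Icc β M) :=
    hN.cF.mono (Icc_subset_Ici_self.trans (Ici_subset_Ici.2 hN.b0))
  unfold PP
  fun_prop

lemma left_lemma {m : ℕ} {f : ℝ → ℝ} {M M₁ M₂ β : ℝ} {r₁ p₁ r₂ p₂ F G : ℝ → ℝ}
    (hN : NL m f F G β) (B₁ : Br_s14 m f M₁ r₁ p₁) (B₂ : Br_s14 m f M₂ r₂ p₂)
    (hM1 : M ≤ M₁) (hM2 : M ≤ M₂) (hbM : β ≤ M)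
    (hr0 : r₁ 0 = r₂ 0) (hp0 : 0 < p₁ 0) (hp0' : p₁ 0 < p₂ 0)
    (hp1 : ∀ s ∈ Ioo 0 M₁, 0 < p₁ s) (hp2 : ∀ s ∈ Ioo 0 M₂, 0 < p₂ s)
    (hp2' : ∀ s ∈ Icc 0 M₂, 0 ≤ p₂ s)
    (hE : ∀ s ∈ Icc 0 M₁, 0 ≤ (p₁ s)^2 + 2 * F s) :
    (∀ s ∈ Icc 0 M, p₁ s < p₂ s ∧ r₂ s ≤ r₁ s) ∧
    (∀ s ∈ Icc β M, ((r₁ s)^(m+1) * p₁ s)^2 < ((r₂ s)^(m+1) * p₂ s)^2) := by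
  have hM0 : 0 ≤ M := hN.b0.trans hbM
  have cr1 : ContinuousOn r₁ (Icc 0 M) := B₁.hr.mono (Icc_subset_Icc_right hM1)
  have cp1 : ContinuousOn p₁ (Icc 0 M) := B₁.hp.mono (Icc_subset_Icc_right hM1)
  have cr2 : ContinuousOn r₂ (Icc 0 M) := B₂.hr.mono (Icc_subset_Icc_right hM2)
  have cp2 : ContinuousOn p₂ (Icc 0 M) := B₂.hp.mono (Icc_subset_Icc_right hM2)
  have cF : ContinuousOn F (Icc 0 M) := hN.cF.mono Icc_subset_Ici_self
  -- key 1
  have key1 : ∀ s ∈ Icc 0 M, (∀ t ∈ Ico 0 s, p₁ t < p₂ t) → r₂ s ≤ r₁ s := by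
    intro s hs ht
    have hsub : Icc 0 s ⊆ Icc 0 M := Icc_subset_Icc_right hs.2
    have := mono_help (g := fun t => r₁ t - r₂ t) hs.1
      ((cr1.mono hsub).sub (cr2.mono hsub)) (by
        intro t h
        have h1 : t ∈ Ioo 0 M₁ := ⟨h.1, h.2.trans_le (hs.2.trans hM1)⟩
        have h2 : t ∈ Ioo 0 M₂ := ⟨h.1, h.2.trans_le (hs.2.trans hM2)⟩
        refine ⟨_, ?_, (B₁.dr t h1).fun_sub (B₂.dr t h2)⟩
        have := inv_anti₀ (hp1 t h1) (ht t ⟨h.1.le, h.2⟩).le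
        linarith)
    simp only [hr0] at this
    linarith
  have key2 : ∀ s ∈ Icc 0 (min M β), (∀ t ∈ Ico 0 s, p₁ t < p₂ t) →
      ((r₁ s)^(m+1))^2 * ((p₁ s)^2 + 2 * F s) < ((r₂ s)^(m+1))^2 * ((p₂ s)^2 + 2 * F s) := by
    intro s hs ht
    have hsM : s ≤ M := hs.2.trans (min_le_left _ _)
    have hsb : s ≤ β := hs.2.trans (min_le_right _ _)
    have hsub : Icc 0 s ⊆ Icc 0 M := Icc_subset_Icc_right hsM
    have cr1 := cr1.mono hsub
    have cr2 := cr2.mono hsub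
    have cp1 := cp1.mono hsub
    have cp2 := cp2.mono hsub
    have cF := cF.mono hsub
    have := mono_help (g := fun t => ((r₂ t)^(m+1))^2 * ((p₂ t)^2 + 2 * F t) -
        ((r₁ t)^(m+1))^2 * ((p₁ t)^2 + 2 * F t)) hs.1 (by fun_prop) (by
        intro t h
        have h1 : t ∈ Ioo 0 M₁ := ⟨h.1, h.2.trans_le (hsM.trans hM1)⟩
        have h2 : t ∈ Ioo 0 M₂ := ⟨h.1, h.2.trans_le (hsM.trans hM2)⟩
        refine ⟨_, ?_, (B₂.dQ h2 (hN.dF t h.1)).fun_sub (B₁.dQ h1 (hN.dF t h.1))⟩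
        have i1 := inv_anti₀ (hp1 t h1) (ht t ⟨h.1.le, h.2⟩).le
        have i2 := key1 t ⟨h.1.le, h.2.le.trans hsM⟩ (fun x hx => ht x ⟨hx.1, hx.2.trans h.2⟩)
        have i3 := hN.Fneg t ⟨h.1.le, h.2.le.trans hsb⟩
        have i4 := B₂.pos t ⟨h2.1.le, h2.2.le⟩
        have i5 : (r₂ t)^(2*m+1) * (p₂ t)⁻¹ ≤ (r₁ t)^(2*m+1) * (p₁ t)⁻¹ := by
          have := (inv_pos.2 (hp2 t h2)).le
          have := B₁.pos t ⟨h1.1.le, h1.2.le⟩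
          gcongr
        have i6 : 4 * ((m:ℝ)+1) * F t ≤ 0 :=
          mul_nonpos_of_nonneg_of_nonpos (by positivity) i3
        have := mul_le_mul_of_nonpos_left i5 i6
        linarith)
    have i0 := B₂.pos 0 ⟨le_rfl, hM0.trans hM2⟩
    have : ((r₂ 0)^(m+1))^2 * (p₁ 0)^2 < ((r₂ 0)^(m+1))^2 * (p₂ 0)^2 := by gcongr
    simp only [hr0] at *
    nlinarith
  have key3 : ∀ s ∈ Icc β M, (∀ t ∈ Ico 0 s, p₁ t < p₂ t) →
      ((r₁ s)^(m+1) * p₁ s)^2 < ((r₂ s)^(m+1) * p₂ s)^2 := by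
    intro s hs ht
    have hb := key2 β ⟨hN.b0, le_min hbM le_rfl⟩ (fun x hx => ht x ⟨hx.1, hx.2.trans_le hs.1⟩)
    rw [hN.Fb] at hb
    have hsub : Icc β s ⊆ Icc 0 M := Icc_subset_Icc hN.b0 hs.2
    have cr1 := cr1.mono hsub
    have cr2 := cr2.mono hsub
    have cp1 := cp1.mono hsub
    have cp2 := cp2.mono hsub
    have := mono_help (g := fun t => ((r₂ t)^(m+1) * p₂ t)^2 -
        ((r₁ t)^(m+1) * p₁ t)^2) hs.1 (by fun_prop) (by
        intro t h
        have h0 : 0 < t := hN.b0.trans_lt h.1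
        have h1 : t ∈ Ioo 0 M₁ := ⟨h0, h.2.trans_le (hs.2.trans hM1)⟩
        have h2 : t ∈ Ioo 0 M₂ := ⟨h0, h.2.trans_le (hs.2.trans hM2)⟩
        refine ⟨_, ?_, (B₂.dW2 h2).fun_sub (B₁.dW2 h1)⟩
        have i2 := key1 t ⟨h0.le, h.2.le.trans hs.2⟩ (fun x hx => ht x ⟨hx.1, hx.2.trans h.2⟩)
        have i3 := hN.fpos t h.1
        have i4 := B₂.pos t ⟨h2.1.le, h2.2.le⟩
        have i5 : ((r₂ t)^(m+1))^2 * f t ≤ ((r₁ t)^(m+1))^2 * f t := by gcongr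
        linarith)
    simp only [mul_pow] at this ⊢
    linarith
  have main : ∀ s ∈ Icc 0 M, 0 < p₂ s - p₁ s := by
    refine cont_up (cp2.sub cp1) (by linarith) ?_
    intro s hs ht
    have ht' : ∀ t ∈ Ico 0 s, p₁ t < p₂ t := fun t h => by linarith [ht t h]
    have hsI : s ∈ Icc 0 M := ⟨hs.1.le, hs.2⟩
    have k1 := key1 s hsI ht'
    have q1 := B₁.pos s ⟨hsI.1, hsI.2.trans hM1⟩
    have q2 := B₂.pos s ⟨hsI.1, hsI.2.trans hM2⟩
    have hpp : 0 ≤ p₂ s := hp2' s ⟨hsI.1, hsI.2.trans hM2⟩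
    have hR : ((r₂ s)^(m+1))^2 ≤ ((r₁ s)^(m+1))^2 := by gcongr
    have hR2 : 0 < ((r₂ s)^(m+1))^2 := by positivity
    have hsq : (p₁ s)^2 < (p₂ s)^2 := by
      rcases le_total s β with hb | hb
      · have k2 := key2 s ⟨hsI.1, le_min hs.2 hb⟩ ht'
        have e := hE s ⟨hsI.1, hsI.2.trans hM1⟩
        by_contra hcon
        push Not at hcon
        have a1 : ((r₂ s)^(m+1))^2 * ((p₂ s)^2 + 2 * F s) ≤ ((r₂ s)^(m+1))^2 * ((p₁ s)^2 + 2 * F s) := by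
          gcongr
        have a2 : ((r₂ s)^(m+1))^2 * ((p₁ s)^2 + 2 * F s) ≤ ((r₁ s)^(m+1))^2 * ((p₁ s)^2 + 2 * F s) := by
          gcongr
        linarith
      · have k3 := key3 s ⟨hb, hs.2⟩ ht'
        simp only [mul_pow] at k3
        by_contra hcon
        push Not at hcon
        have a1 : ((r₂ s)^(m+1))^2 * ((p₂ s)^2) ≤ ((r₁ s)^(m+1))^2 * ((p₁ s)^2) := by
          gcongr
        linarith
    have := lt_of_pow_lt_pow_left₀ 2 hpp hsq
    linarith
  have main' : ∀ s ∈ Icc 0 M, p₁ s < p₂ s := fun s hs => by linarith [main s hs]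
  refine ⟨fun s hs => ⟨main' s hs, key1 s hs fun t ht => main' t ⟨ht.1, ht.2.le.trans hs.2⟩⟩, ?_⟩
  intro s hs
  exact key3 s hs fun t ht => main' t ⟨ht.1, ht.2.le.trans hs.2⟩

lemma leftP {m : ℕ} {f : ℝ → ℝ} {M₁ M₂ β : ℝ} {r₁ p₁ r₂ p₂ F G : ℝ → ℝ}
    (hN : NL m f F G β) (B₁ : Br_s14 m f M₁ r₁ p₁) (B₂ : Br_s14 m f M₂ r₂ p₂)
    (hM : M₁ ≤ M₂) (hbM : β ≤ M₁)
    (hp1 : ∀ s ∈ Icc 0 M₁, 0 ≤ p₁ s) (hp2 : ∀ s ∈ Icc 0 M₂, 0 ≤ p₂ s)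
    (hr : ∀ s ∈ Icc 0 M₁, r₂ s ≤ r₁ s)
    (hW : ∀ s ∈ Icc β M₁, ((r₁ s)^(m+1) * p₁ s)^2 < ((r₂ s)^(m+1) * p₂ s)^2) :
    PP m F G r₂ p₂ M₁ < PP m F G r₁ p₁ M₁ := by
  have := mono_help (g := fun t => PP m F G r₁ p₁ t - PP m F G r₂ p₂ t) hbM
    ((PP_cont B₁ hN).sub ((PP_cont B₂ hN).mono (Icc_subset_Icc_right hM))) (by
      intro t h
      have h0 : 0 < t := hN.b0.trans_lt h.1
      have h1 : t ∈ Ioo 0 M₁ := ⟨h0, h.2⟩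
      have h2 : t ∈ Ioo 0 M₂ := ⟨h0, h.2.trans_le hM⟩
      obtain ⟨d, hd, hG⟩ := hN.dG t h.1
      refine ⟨_, ?_, (B₁.dP h1 (hN.dF t h0) hG (hN.GF t h.1)).fun_sub
        (B₂.dP h2 (hN.dF t h0) hG (hN.GF t h.1))⟩
      have w := hW t ⟨h.1.le, h.2.le⟩
      have q2 := B₂.pos t ⟨h2.1.le, h2.2.le⟩
      have w2 : 0 ≤ (r₂ t)^(m+1) * p₂ t := mul_nonneg (by positivity) (hp2 t ⟨h2.1.le, h2.2.le⟩)
      have w3 := lt_of_pow_lt_pow_left₀ 2 w2 w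
      nlinarith)
  have hb : PP m F G r₂ p₂ β < PP m F G r₁ p₁ β := by
    simp only [PP, hN.Fb, hN.Gb]
    have w := hW β ⟨le_rfl, hbM⟩
    have q2 := B₂.pos β ⟨hN.b0, hbM.trans hM⟩
    have q1 := B₁.pos β ⟨hN.b0, hbM⟩
    have q := hr β ⟨hN.b0, hbM⟩
    suffices hh : (r₁ β)^(m+2) * (p₁ β)^2 < (r₂ β)^(m+2) * (p₂ β)^2 by linarith
    have e1 : ∀ x y : ℝ, x^m * (x^(m+2) * y^2) = (x^(m+1) * y)^2 := by intros; ring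
    rw [← e1, ← e1] at w
    have hR : (r₂ β)^m ≤ (r₁ β)^m := by gcongr
    by_contra hcon
    push Not at hcon
    have a1 : (r₂ β)^m * ((r₂ β)^(m+2) * (p₂ β)^2) ≤ (r₁ β)^m * ((r₁ β)^(m+2) * (p₁ β)^2) := by
      gcongr
    linarith
  linarith

lemma Pside {m : ℕ} {f : ℝ → ℝ} {M β : ℝ} {r p F G : ℝ → ℝ}
    (hN : NL m f F G β) (B : Br_s14 m f M r p) {x y : ℝ} (hx : β ≤ x) (hxy : x ≤ y) (hy : y ≤ M) :
    ((∀ s ∈ Icc 0 M, 0 ≤ p s) → PP m F G r p y ≤ PP m F G r p x) ∧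
    ((∀ s ∈ Icc 0 M, p s ≤ 0) → PP m F G r p x ≤ PP m F G r p y) := by
  constructor
  · intro hp
    refine anti_help hxy ((PP_cont B hN).mono (Icc_subset_Icc hx hy)) ?_
    intro t h
    have hb : β < t := hx.trans_lt h.1
    have h0 : 0 < t := hN.b0.trans_lt hb
    have h1 : t ∈ Ioo 0 M := ⟨h0, h.2.trans_le hy⟩
    obtain ⟨d, hd, hG⟩ := hN.dG t hb
    refine ⟨_, ?_, B.dP h1 (hN.dF t h0) hG (hN.GF t hb)⟩
    have q := B.pos t ⟨h1.1.le, h1.2.le⟩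
    have w : 0 ≤ (r t)^(m+1) * p t := mul_nonneg (by positivity) (hp t ⟨h1.1.le, h1.2.le⟩)
    nlinarith
  · intro hp
    refine mono_help hxy ((PP_cont B hN).mono (Icc_subset_Icc hx hy)) ?_
    intro t h
    have hb : β < t := hx.trans_lt h.1
    have h0 : 0 < t := hN.b0.trans_lt hb
    have h1 : t ∈ Ioo 0 M := ⟨h0, h.2.trans_le hy⟩
    obtain ⟨d, hd, hG⟩ := hN.dG t hb
    refine ⟨_, ?_, B.dP h1 (hN.dF t h0) hG (hN.GF t hb)⟩
    have q := B.pos t ⟨h1.1.le, h1.2.le⟩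
    have w : (r t)^(m+1) * p t ≤ 0 :=
      mul_nonpos_of_nonneg_of_nonpos (by positivity) (hp t ⟨h1.1.le, h1.2.le⟩)
    nlinarith

lemma right_lemma {m : ℕ} {f : ℝ → ℝ} {M₁ M₂ β s₀ : ℝ} {r₁ p₁ r₂ p₂ F G : ℝ → ℝ}
    (hN : NL m f F G β) (B₁ : Br_s14 m f M₁ r₁ p₁) (B₂ : Br_s14 m f M₂ r₂ p₂)
    (hs1 : s₀ ≤ M₁) (hs2 : s₀ < M₂) (hb : β < s₀)
    (hp1 : ∀ s ∈ Icc 0 M₁, p₁ s ≤ 0) (hp2 : ∀ s ∈ Icc 0 M₂, p₂ s ≤ 0)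
    (hP2 : ∀ s ∈ Icc β M₂, PP m F G r₂ p₂ s ≤ 0)
    (hr : r₂ s₀ ≤ r₁ s₀) (hW : (r₂ s₀)^(m+1) * p₂ s₀ < (r₁ s₀)^(m+1) * p₁ s₀)
    (hP : PP m F G r₂ p₂ s₀ < PP m F G r₁ p₁ s₀) :
    r₂ β < r₁ β ∧ r₂ β * p₂ β < r₁ β * p₁ β := by
  have hsub1 : Icc β s₀ ⊆ Icc 0 M₁ := Icc_subset_Icc hN.b0 hs1
  have hsub2 : Icc β s₀ ⊆ Icc 0 M₂ := Icc_subset_Icc hN.b0 hs2.le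
  have I1 : ∀ t ∈ Ioo β s₀, t ∈ Ioo 0 M₁ := fun t h => ⟨hN.b0.trans_lt h.1, h.2.trans_le hs1⟩
  have I2 : ∀ t ∈ Ioo β s₀, t ∈ Ioo 0 M₂ := fun t h => ⟨hN.b0.trans_lt h.1, h.2.trans hs2⟩
  have cr1 := B₁.hr.mono hsub1
  have cp1 := B₁.hp.mono hsub1
  have cr2 := B₂.hr.mono hsub2
  have cp2 := B₂.hp.mono hsub2
  have q1 : ∀ t ∈ Icc β s₀, 0 < r₁ t := fun t h => B₁.pos t (hsub1 h)
  have q2 : ∀ t ∈ Icc β s₀, 0 < r₂ t := fun t h => B₂.pos t (hsub2 h)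
  have cP1 : ContinuousOn (PP m F G r₁ p₁) (Icc β s₀) :=
    (PP_cont B₁ hN).mono (Icc_subset_Icc_right hs1)
  have cP2 : ContinuousOn (PP m F G r₂ p₂) (Icc β s₀) :=
    (PP_cont B₂ hN).mono (Icc_subset_Icc_right hs2.le)
  have hs0 : s₀ ∈ Icc β s₀ := ⟨hb.le, le_rfl⟩
  have hbI : β ∈ Icc β s₀ := ⟨le_rfl, hb.le⟩
  -- p₁ strictly negative in the open interval
  have n1 : ∀ t ∈ Ioo β s₀, p₁ t < 0 := fun t h =>
    lt_of_le_of_ne (hp1 t (hsub1 ⟨h.1.le, h.2.le⟩)) (B₁.ne t (I1 t h))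
  have n2 : ∀ t ∈ Icc β s₀, p₂ t < 0 := by
    intro t h
    have hsub : Icc t s₀ ⊆ Icc β s₀ := Icc_subset_Icc_left h.1
    have cr2 := cr2.mono hsub
    have cp2 := cp2.mono hsub
    have := anti_help (g := fun t => ((r₂ t)^(m+1) * p₂ t)^2) h.2 (by fun_prop) (by
      intro x hx
      have hx' : x ∈ Ioo β s₀ := ⟨h.1.trans_lt hx.1, hx.2⟩
      refine ⟨_, ?_, B₂.dW2 (I2 x hx')⟩
      have := hN.fpos x hx'.1
      have : 0 ≤ ((r₂ x)^(m+1))^2 * f x := by positivity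
      linarith)
    have h1 : (r₂ s₀)^(m+1) * p₂ s₀ < 0 :=
      hW.trans_le (mul_nonpos_of_nonneg_of_nonpos (pow_pos (q1 _ hs0) _).le (hp1 _ (hsub1 hs0)))
    refine lt_of_le_of_ne (hp2 t (hsub2 h)) ?_
    intro h0
    simp only [h0] at this
    nlinarith
  -- key: comparison of radii
  have key : ∀ s ∈ Icc β s₀, (∀ t ∈ Ioc s s₀, r₂ t * p₂ t < r₁ t * p₁ t) → r₂ s ≤ r₁ s ∧
      (s < s₀ → r₂ s < r₁ s) := by
    intro s hs ht
    have hsub : Icc s s₀ ⊆ Icc β s₀ := Icc_subset_Icc_left hs.1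
    have cl1 : ContinuousOn (fun t => Real.log (r₁ t)) (Icc s s₀) :=
      (cr1.mono hsub).log (fun t h => (q1 t (hsub h)).ne')
    have cl2 : ContinuousOn (fun t => Real.log (r₂ t)) (Icc s s₀) :=
      (cr2.mono hsub).log (fun t h => (q2 t (hsub h)).ne')
    have hstrict : s < s₀ → r₂ s < r₁ s := by
      intro hlt
      have := smono_help (g := fun t => Real.log (r₂ t) - Real.log (r₁ t)) hlt
        (cl2.sub cl1) (by
          intro x hx
          have hx' : x ∈ Ioo β s₀ := ⟨hs.1.trans_lt hx.1, hx.2⟩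
          have hx'' : x ∈ Icc β s₀ := ⟨hx'.1.le, hx'.2.le⟩
          refine ⟨_, ?_, (B₂.dlog (I2 x hx')).fun_sub (B₁.dlog (I1 x hx'))⟩
          have a1 : r₁ x * p₁ x < 0 := mul_neg_of_pos_of_neg (q1 x hx'') (n1 x hx')
          have a3 := ht x ⟨hx.1, hx.2.le⟩
          have a2 : r₂ x * p₂ x < 0 := a3.trans a1
          have := (inv_lt_inv_of_neg a1 a2).2 a3
          linarith)
      have h2 := Real.log_le_log (q2 _ hs0) hr
      have h3 : Real.log (r₂ s) < Real.log (r₁ s) := by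
        linarith
      exact (Real.log_lt_log_iff (q2 s hs) (q1 s hs)).1 h3
    refine ⟨?_, hstrict⟩
    rcases hs.2.lt_or_eq with h | h
    · exact (hstrict h).le
    · rw [h]; exact hr
  have hD0 : r₂ s₀ * p₂ s₀ < r₁ s₀ * p₁ s₀ := by
    by_contra hcon
    push Not at hcon
    have e1 : ∀ x y : ℝ, x^(m+1) * y = x^m * (x * y) := by intros; ring
    rw [e1, e1] at hW
    have a1 : r₂ s₀ * p₂ s₀ ≤ 0 :=
      mul_nonpos_of_nonneg_of_nonpos (q2 _ hs0).le (n2 _ hs0).le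
    have a2 := (q2 _ hs0).le
    have a3 := (q1 _ hs0).le
    have hR : (r₂ s₀)^m ≤ (r₁ s₀)^m := by gcongr
    have b1 := mul_le_mul_of_nonpos_right hR a1
    have b2 := mul_le_mul_of_nonneg_left hcon (pow_nonneg a3 m)
    linarith
  have main : ∀ s ∈ Icc β s₀, 0 < r₁ s * p₁ s - r₂ s * p₂ s := by
    refine cont_down (by fun_prop) (by linarith) ?_
    intro s hs ht
    have ht' : ∀ t ∈ Ioc s s₀, r₂ t * p₂ t < r₁ t * p₁ t := fun t h => by linarith [ht t h]
    have hsI : s ∈ Icc β s₀ := ⟨hs.1, hs.2.le⟩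
    have hsub : Icc s s₀ ⊆ Icc β s₀ := Icc_subset_Icc_left hs.1
    have kr : ∀ t ∈ Icc s s₀, r₂ t ≤ r₁ t := fun t h =>
      (key t (hsub h) (fun x hx => ht' x ⟨h.1.trans_lt hx.1, hx.2⟩)).1
    -- D s ≥ 0
    have hge : r₂ s * p₂ s ≤ r₁ s * p₁ s := by
      have hcl : ContinuousWithinAt (fun t => r₁ t * p₁ t - r₂ t * p₂ t) (Ioc s s₀) s :=
        ((by fun_prop : ContinuousOn (fun t => r₁ t * p₁ t - r₂ t * p₂ t) (Icc β s₀)) s hsI).mono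
          (Ioc_subset_Icc_self.trans hsub)
      have hcl2 : s ∈ closure (Ioc s s₀) := by
        rw [closure_Ioc hs.2.ne]; exact ⟨le_rfl, hs.2.le⟩
      have := hcl.mem_closure (t := Ici 0) hcl2 (fun t h => (ht t h).le)
      rw [isClosed_Ici.closure_eq] at this
      have h2 : 0 ≤ r₁ s * p₁ s - r₂ s * p₂ s := this
      linarith
    by_contra hcon
    have heq : r₁ s * p₁ s = r₂ s * p₂ s := by linarith
    -- the quotient
    set W₁ : ℝ → ℝ := fun t => (r₁ t)^(m+1) * p₁ t with hW1
    set W₂ : ℝ → ℝ := fun t => (r₂ t)^(m+1) * p₂ t with hW2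
    have W2neg : ∀ t ∈ Icc β s₀, W₂ t < 0 := fun t h =>
      mul_neg_of_pos_of_neg (pow_pos (q2 t h) _) (n2 t h)
    have cW1 : ContinuousOn W₁ (Icc β s₀) := by fun_prop
    have cW2 : ContinuousOn W₂ (Icc β s₀) := by fun_prop
    have cS : ContinuousOn (fun t => W₁ t / W₂ t) (Icc β s₀) :=
      cW1.div cW2 (fun t h => (W2neg t h).ne)
    have dS : ∀ t ∈ Ioo s s₀, ∃ d, d ≤ 0 ∧ HasDerivAt (fun t => W₁ t / W₂ t) d t := by
      intro t h
      have h' : t ∈ Ioo β s₀ := ⟨hs.1.trans_lt h.1, h.2⟩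
      have h'' : t ∈ Icc β s₀ := ⟨h'.1.le, h'.2.le⟩
      refine ⟨_, ?_, (B₁.dW (I1 t h')).fun_div (B₂.dW (I2 t h')) (W2neg t h'').ne⟩
      apply div_nonpos_of_nonpos_of_nonneg _ (sq_nonneg _)
      have a1 := n1 t h'
      have a2 := n2 t h''
      have a3 := q1 t h''
      have a4 := q2 t h''
      have a5 := kr t ⟨h.1.le, h.2.le⟩
      have a6 := ht' t ⟨h.1, h.2.le⟩
      have a7 := hN.fpos t h'.1
      have a8 : p₂ t ≤ p₁ t := by
        by_contra hc
        push Not at hc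
        have : r₁ t * p₁ t ≤ r₂ t * p₁ t := mul_le_mul_of_nonpos_right a5 a1.le
        have : r₂ t * p₁ t ≤ r₂ t * p₂ t := mul_le_mul_of_nonneg_left hc.le a4.le
        linarith
      have e : -(r₁ t ^ (m + 1) * f t * (p₁ t)⁻¹) * (r₂ t ^ (m + 1) * p₂ t) -
          r₁ t ^ (m + 1) * p₁ t * -(r₂ t ^ (m + 1) * f t * (p₂ t)⁻¹) =
          (r₁ t ^ (m + 1) * r₂ t ^ (m + 1) * f t) * (((p₁ t)^2 - (p₂ t)^2) / (p₁ t * p₂ t)) := by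
        field_simp
        ring
      rw [e]
      apply mul_nonpos_of_nonneg_of_nonpos (by positivity)
      apply div_nonpos_of_nonpos_of_nonneg _ (mul_pos_of_neg_of_neg a1 a2).le
      nlinarith
    have Santi : ∀ x y, s ≤ x → x ≤ y → y ≤ s₀ → W₁ y / W₂ y ≤ W₁ x / W₂ x := by
      intro x y hx hxy hy
      exact anti_help (g := fun t => W₁ t / W₂ t) hxy
        (cS.mono (Icc_subset_Icc (hs.1.trans hx) hy))
        (fun t h => dS t ⟨hx.trans_lt h.1, h.2.trans_le hy⟩)
    have hSs0 : W₁ s₀ / W₂ s₀ < 1 := by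
      rw [div_lt_one_of_neg (W2neg s₀ hs0)]; exact hW
    have Ss : W₁ s / W₂ s = (r₁ s)^m / (r₂ s)^m := by
      have a2 := n2 s hsI
      have a4 := (q2 s hsI).ne'
      have e1 : ∀ x y : ℝ, x^(m+1) * y = x^m * (x * y) := by intros; ring
      simp only [hW1, hW2, e1, heq]
      rw [mul_div_mul_right]
      exact (mul_neg_of_pos_of_neg (q2 s hsI) a2).ne
    have hSs : 1 ≤ W₁ s / W₂ s := by
      rw [Ss, one_le_div (pow_pos (q2 s hsI) _)]
      have := (q2 s hsI).le
      have := kr s ⟨le_rfl, hs.2.le⟩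
      gcongr
    obtain ⟨z, hz, hz1⟩ := intermediate_value_Icc' hs.2.le (cS.mono hsub) ⟨hSs0.le, hSs⟩
    simp only at hz1
    have hzb : β ≤ z := hs.1.trans hz.1
    have step1 := anti_help (g := fun t => PP m F G r₁ p₁ t - PP m F G r₂ p₂ t) hz.2
      ((cP1.sub cP2).mono (Icc_subset_Icc_left hzb)) (by
        intro t h
        have h' : t ∈ Ioo β s₀ := ⟨hzb.trans_lt h.1, h.2⟩
        have h0 : 0 < t := hN.b0.trans_lt h'.1
        obtain ⟨d, hd, hG⟩ := hN.dG t h'.1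
        refine ⟨_, ?_, (B₁.dP (I1 t h') (hN.dF t h0) hG (hN.GF t h'.1)).fun_sub
          (B₂.dP (I2 t h') (hN.dF t h0) hG (hN.GF t h'.1))⟩
        have hS := Santi z t hz.1 h.1.le h.2.le
        rw [hz1, div_le_one_of_neg (W2neg t ⟨h'.1.le, h'.2.le⟩)] at hS
        simp only [hW1, hW2] at hS
        nlinarith)
    have step2 := anti_help
      (g := fun t => PP m F G r₁ p₁ t - W₁ t / W₂ t * PP m F G r₂ p₂ t) hz.1
      ((cP1.sub (cS.mul cP2)).mono (Icc_subset_Icc hs.1 hz.2)) (by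
        intro t h
        have h' : t ∈ Ioo β s₀ := ⟨hs.1.trans_lt h.1, h.2.trans_le hz.2⟩
        have h0 : 0 < t := hN.b0.trans_lt h'.1
        obtain ⟨d, hd, hG⟩ := hN.dG t h'.1
        obtain ⟨e, he, hSd⟩ := dS t ⟨h.1, h.2.trans_le hz.2⟩
        refine ⟨_, ?_, (B₁.dP (I1 t h') (hN.dF t h0) hG (hN.GF t h'.1)).fun_sub
          (hSd.fun_mul (B₂.dP (I2 t h') (hN.dF t h0) hG (hN.GF t h'.1)))⟩
        have hw := (W2neg t ⟨h'.1.le, h'.2.le⟩).ne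
        have e2 : W₁ t / W₂ t * (((m:ℝ) - 2 * ((m:ℝ)+2) * d) * W₂ t) =
            ((m:ℝ) - 2 * ((m:ℝ)+2) * d) * W₁ t := by
          field_simp
        have hpp := hP2 t ⟨h'.1.le, h'.2.le.trans hs2.le⟩
        have := mul_nonneg_of_nonpos_of_nonpos he hpp
        simp only [hW1, hW2] at e2 ⊢
        linarith)
    simp only [hz1] at step1 step2
    have fin : PP m F G r₁ p₁ s - W₁ s / W₂ s * PP m F G r₂ p₂ s ≤ 0 := by
      have hF : 0 ≤ F s := by
        rcases hs.1.lt_or_eq with h | h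
        · exact (hN.Fpos s h).le
        · rw [← h, hN.Fb]
      have a4 := (q2 s hsI)
      have a3 := (q1 s hsI)
      have ePP : ∀ r p : ℝ → ℝ, PP m F G r p s = (r s)^m * (-2 * ((m:ℝ)+2) * G s * (r s * p s)
          - (r s * p s)^2 - 2 * (r s)^2 * F s) := by
        intro r p; unfold PP; ring
      rw [Ss, ePP, ePP, heq]
      have e3 : (r₁ s)^m / (r₂ s)^m * ((r₂ s)^m * (-2 * ((m:ℝ)+2) * G s * (r₂ s * p₂ s)
          - (r₂ s * p₂ s)^2 - 2 * (r₂ s)^2 * F s)) = (r₁ s)^m * (-2 * ((m:ℝ)+2) * G s * (r₂ s * p₂ s)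
          - (r₂ s * p₂ s)^2 - 2 * (r₂ s)^2 * F s) := by
        have : (r₂ s)^m ≠ 0 := (pow_pos a4 _).ne'
        field_simp
      rw [e3, ← mul_sub]
      apply mul_nonpos_of_nonneg_of_nonpos (by positivity)
      have := kr s ⟨le_rfl, hs.2.le⟩
      have : (r₂ s)^2 * F s ≤ (r₁ s)^2 * F s := by gcongr
      linarith
    linarith
  refine ⟨(key β hbI (fun t h => by linarith [main t ⟨h.1.le, h.2⟩])).2 hb, by linarith [main β hbI]⟩

lemma right_start {m : ℕ} {f : ℝ → ℝ} {M₁ M₂ β : ℝ} {r₁ p₁ r₂ p₂ F G : ℝ → ℝ}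
    (hN : NL m f F G β) (B₁ : Br_s14 m f M₁ r₁ p₁) (B₂ : Br_s14 m f M₂ r₂ p₂)
    (hM : M₁ < M₂) (hb : β < M₁)
    (hp1 : ∀ s ∈ Icc 0 M₁, p₁ s ≤ 0) (hp2 : ∀ s ∈ Icc 0 M₂, p₂ s ≤ 0)
    (hpM : p₁ M₁ = 0)
    (hP2 : ∀ s ∈ Icc β M₂, PP m F G r₂ p₂ s ≤ 0)
    (hP : PP m F G r₂ p₂ M₁ < PP m F G r₁ p₁ M₁)
    (hcase : (r₁ M₁ < r₂ M₁ ∧ ∃ s ∈ Ioo β M₁, r₁ s = r₂ s) ∨ r₂ M₁ ≤ r₁ M₁) :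
    r₂ β < r₁ β ∧ r₂ β * p₂ β < r₁ β * p₁ β := by
  have hM0 : 0 < M₁ := hN.b0.trans_lt hb
  have hpM2 : p₂ M₁ < 0 :=
    lt_of_le_of_ne (hp2 _ ⟨hM0.le, hM.le⟩) (B₂.ne _ ⟨hM0, hM⟩)
  have hrM2 := B₂.pos M₁ ⟨hM0.le, hM.le⟩
  have hWM : (r₂ M₁)^(m+1) * p₂ M₁ < (r₁ M₁)^(m+1) * p₁ M₁ := by
    rw [hpM, mul_zero]; exact mul_neg_of_pos_of_neg (by positivity) hpM2
  rcases hcase with ⟨hlt, sx, hsx, hsx'⟩ | hge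
  swap
  · exact right_lemma hN B₁ B₂ le_rfl hM hb hp1 hp2 hP2 hge hWM hP
  have hsub1 : Icc sx M₁ ⊆ Icc 0 M₁ := Icc_subset_Icc_left (hN.b0.trans hsx.1.le)
  have hsub2 : Icc sx M₁ ⊆ Icc 0 M₂ := Icc_subset_Icc (hN.b0.trans hsx.1.le) hM.le
  have cr1 := B₁.hr.mono hsub1
  have cp1 := B₁.hp.mono hsub1
  have cr2 := B₂.hr.mono hsub2
  have cp2 := B₂.hp.mono hsub2
  have hcl : IsClosed (Icc sx M₁ ∩ (fun t => r₂ t - r₁ t) ⁻¹' Iic 0) :=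
    (cr2.sub cr1).preimage_isClosed_of_isClosed isClosed_Icc isClosed_Iic
  have hcp : IsCompact (Icc sx M₁ ∩ (fun t => r₂ t - r₁ t) ⁻¹' Iic 0) :=
    isCompact_Icc.of_isClosed_subset hcl inter_subset_left
  obtain ⟨z, ⟨hz1, hz2⟩, hmax⟩ := hcp.exists_isGreatest
    ⟨sx, ⟨le_rfl, hsx.2.le⟩, by simp [hsx']⟩
  have hz2' : r₂ z - r₁ z ≤ 0 := hz2
  have hgt : ∀ t ∈ Ioc z M₁, r₁ t < r₂ t := by
    intro t ht
    by_contra hc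
    push Not at hc
    have := hmax ⟨⟨hz1.1.trans ht.1.le, ht.2⟩, (by
      have : r₂ t - r₁ t ≤ 0 := by linarith
      exact this)⟩
    linarith [ht.1]
  have hzb : β < z := hsx.1.trans_le hz1.1
  have hzb0 : 0 < z := hN.b0.trans_lt hzb
  have hWz : ∀ t ∈ Icc z M₁, (r₂ t)^(m+1) * p₂ t < (r₁ t)^(m+1) * p₁ t := by
    intro t ht
    have hsub : Icc t M₁ ⊆ Icc sx M₁ := Icc_subset_Icc_left (hz1.1.trans ht.1)
    have cr1 := cr1.mono hsub
    have cp1 := cp1.mono hsub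
    have cr2 := cr2.mono hsub
    have cp2 := cp2.mono hsub
    have := anti_help (g := fun t => ((r₂ t)^(m+1) * p₂ t)^2 - ((r₁ t)^(m+1) * p₁ t)^2) ht.2
      (by fun_prop) (by
        intro x hx
        have x0 : 0 < x := hzb0.trans_le (ht.1.trans hx.1.le)
        have h1 : x ∈ Ioo 0 M₁ := ⟨x0, hx.2⟩
        have h2 : x ∈ Ioo 0 M₂ := ⟨x0, hx.2.trans hM⟩
        refine ⟨_, ?_, (B₂.dW2 h2).fun_sub (B₁.dW2 h1)⟩
        have i2 := (hgt x ⟨ht.1.trans_lt hx.1, hx.2.le⟩).le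
        have i3 := hN.fpos x (hzb.trans_le (ht.1.trans hx.1.le))
        have i4 := B₁.pos x ⟨h1.1.le, h1.2.le⟩
        have i5 : ((r₁ x)^(m+1))^2 * f x ≤ ((r₂ x)^(m+1))^2 * f x := by gcongr
        linarith)
    have hneg : (r₂ M₁)^(m+1) * p₂ M₁ < 0 := mul_neg_of_pos_of_neg (by positivity) hpM2
    have hsq : 0 < ((r₂ M₁)^(m+1) * p₂ M₁)^2 := by nlinarith
    simp only [hpM] at this
    have t0 : 0 ≤ t := hzb0.le.trans ht.1
    have w2 : (r₂ t)^(m+1) * p₂ t ≤ 0 := mul_nonpos_of_nonneg_of_nonpos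
      (pow_pos (B₂.pos t ⟨t0, ht.2.trans hM.le⟩) _).le (hp2 t ⟨t0, ht.2.trans hM.le⟩)
    have w1 : (r₁ t)^(m+1) * p₁ t ≤ 0 := mul_nonpos_of_nonneg_of_nonpos
      (pow_pos (B₁.pos t ⟨t0, ht.2⟩) _).le (hp1 t ⟨t0, ht.2⟩)
    nlinarith
  have hPz := anti_help (g := fun t => PP m F G r₁ p₁ t - PP m F G r₂ p₂ t) hz1.2
    (((PP_cont B₁ hN).mono (Icc_subset_Icc_left hzb.le)).sub
      ((PP_cont B₂ hN).mono (Icc_subset_Icc hzb.le hM.le))) (by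
      intro t h
      have hb' : β < t := hzb.trans h.1
      have h0 : 0 < t := hN.b0.trans_lt hb'
      obtain ⟨d, hd, hG⟩ := hN.dG t hb'
      refine ⟨_, ?_, (B₁.dP ⟨h0, h.2⟩ (hN.dF t h0) hG (hN.GF t hb')).fun_sub
        (B₂.dP ⟨h0, h.2.trans hM⟩ (hN.dF t h0) hG (hN.GF t hb'))⟩
      have hS := hWz t ⟨h.1.le, h.2.le⟩
      nlinarith)
  refine right_lemma hN B₁ B₂ hz1.2 (hz1.2.trans_lt hM) hzb hp1 hp2 hP2 (by linarith)
    (hWz z ⟨le_rfl, hz1.2⟩) ?_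
  linarith

lemma Fint_facts {f : ℝ → ℝ} (hf : ContinuousOn f (Ici 0)) :
    (∀ s, 0 < s → HasDerivAt (Fint f) (f s) s) ∧ ContinuousOn (Fint f) (Ici 0) := by
  set g : ℝ → ℝ := fun t => f (max 0 t) with hg
  have hgc : Continuous g :=
    hf.comp_continuous (continuous_const.max continuous_id) (fun t => mem_Ici.2 (le_max_left 0 t))
  have hd : ∀ s, HasDerivAt (fun s => ∫ t in (0:ℝ)..s, g t) (g s) s := fun s =>
    (hgc.integral_hasStrictDerivAt 0 s).hasDerivAt
  have he : ∀ s ∈ Ici (0:ℝ), Fint f s = ∫ t in (0:ℝ)..s, g t := by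
    intro s hs
    unfold Fint
    apply intervalIntegral.integral_congr
    intro t ht
    rw [uIcc_of_le hs] at ht
    simp only [hg, max_eq_right ht.1]
  constructor
  · intro s hs
    have h1 := hd s
    have : g s = f s := by simp only [hg, max_eq_right hs.le]
    rw [this] at h1
    refine h1.congr_of_eventuallyEq ?_
    filter_upwards [Ioi_mem_nhds hs] with t ht
    exact he t (mem_Ici.2 (le_of_lt (mem_Ioi.1 ht)))
  · have : ContinuousOn (fun s => ∫ t in (0:ℝ)..s, g t) (Ici 0) :=
      fun s _ => (hd s).continuousAt.continuousWithinAt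
    exact this.congr he

lemma mkNL {m : ℕ} {f : ℝ → ℝ} {β B : ℝ}
    (hf1 : CondF1 f) (hf2 : CondF2 f β B) (hf3 : CondF3 (m+2) f β) :
    NL m f (Fint f) (fun t => Fint f t / f t) β := by
  have hf := hf1.1
  obtain ⟨hdF, hcF⟩ := Fint_facts hf
  have F0 : Fint f 0 = 0 := by simp [Fint]
  have hb0 : 0 ≤ β := by
    rcases hf2 with h | h
    · exact h.1.ge
    · exact (h.2.1.trans h.2.2.1).le
  have hfpos : ∀ s, β < s → 0 < f s := by
    intro s hs
    rcases hf2 with h | h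
    · exact h.2.2.2 s (by rw [← h.1]; exact hs)
    · exact h.2.2.2.1 s (h.2.2.1.trans hs)
  have hFb : Fint f β = 0 := by
    rcases hf2 with h | h
    · rw [h.1, F0]
    · exact h.2.2.2.2.2.2
  have hFpos : ∀ s, β < s → 0 < Fint f s := by
    intro s hs
    have := smono_help (g := Fint f) hs
      (hcF.mono (Icc_subset_Ici_self.trans (Ici_subset_Ici.2 hb0)))
      (fun t h => ⟨f t, hfpos t h.1, hdF t (hb0.trans_lt h.1)⟩)
    linarith
  have hdG : ∀ s, β < s → ∃ d, (m:ℝ) ≤ 2 * ((m:ℝ) + 2) * d ∧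
      HasDerivAt (fun t => Fint f t / f t) d s := by
    intro s hs
    obtain ⟨d, hd, h⟩ := hf3 s hs
    refine ⟨d, ?_, h⟩
    push_cast at hd
    have hm : (0:ℝ) < 2 * ((m:ℝ)+2) := by positivity
    rw [div_le_iff₀ hm] at hd
    linarith
  have hGb : Fint f β / f β = 0 := by rw [hFb, zero_div]
  refine ⟨hb0, hdF, hcF, ?_, hFpos, hFb, hfpos, ?_, hGb, ?_, hdG⟩
  · intro s hs
    rcases hf2 with h | h
    · have : s = 0 := le_antisymm (by rw [← h.1]; exact hs.2) hs.1
      rw [this, F0]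
    · rcases le_total s B with hB | hB
      · have := anti_help (g := Fint f) hs.1 (hcF.mono Icc_subset_Ici_self)
          (fun t ht => ⟨f t, h.2.2.2.2.1 t ⟨ht.1.le, ht.2.le.trans hB⟩, hdF t ht.1⟩)
        linarith
      · have := mono_help (g := Fint f) hs.2
          (hcF.mono (Icc_subset_Ici_self.trans (Ici_subset_Ici.2 hs.1)))
          (fun t ht => ⟨f t, (h.2.2.2.1 t (hB.trans_lt ht.1)).le, hdF t (hs.1.trans_lt ht.1)⟩)
        linarith
  · intro s hs
    rcases (show β ≤ s from hs).lt_or_eq with h | h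
    · obtain ⟨d, -, hd⟩ := hdG s h
      exact hd.continuousAt.continuousWithinAt
    · subst h
      rcases hf2 with h | h
      · have hb : β = 0 := h.1
        subst hb
        have Gmono : ∀ x y, 0 < x → x ≤ y → Fint f x / f x ≤ Fint f y / f y := by
          intro x y hx hxy
          refine mono_help (g := fun t => Fint f t / f t) hxy ?_ ?_
          · intro t ht
            obtain ⟨d, -, hd⟩ := hdG t (hx.trans_le ht.1)
            exact hd.continuousAt.continuousWithinAt
          · intro t ht
            obtain ⟨d, h1, hd⟩ := hdG t (hx.trans ht.1)
            refine ⟨d, ?_, hd⟩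
            have hm : (0:ℝ) < 2 * ((m:ℝ)+2) := by positivity
            have hm' : (0:ℝ) ≤ m := by positivity
            by_contra hc
            push Not at hc
            nlinarith
        rw [Metric.continuousWithinAt_iff]
        intro ε hε
        have hex : ∃ δ > 0, Fint f δ / f δ < ε := by
          by_contra hc
          push Not at hc
          have := anti_help (g := fun t => Fint f t * Real.exp (-(t/ε))) zero_le_one
            ((hcF.mono Icc_subset_Ici_self).mul (by fun_prop)) (by
              intro t ht
              have hde : HasDerivAt (fun t : ℝ => Real.exp (-(t/ε)))
                  (Real.exp (-(t/ε)) * (-(1/ε))) t :=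
                (((hasDerivAt_id t).div_const ε).neg).exp
              refine ⟨_, ?_, (hdF t ht.1).fun_mul hde⟩
              have h1 := hc t ht.1
              rw [le_div_iff₀ (hfpos t ht.1)] at h1
              have h2 : f t ≤ Fint f t * (1/ε) := by
                rw [mul_one_div, le_div_iff₀ hε]; linarith
              have h3 := Real.exp_pos (-(t/ε))
              nlinarith)
          simp only [F0, zero_mul] at this
          have h1 := hFpos 1 one_pos
          have h3 := Real.exp_pos (-(1/ε))
          nlinarith
        obtain ⟨δ, hδ, hGδ⟩ := hex
        refine ⟨δ, hδ, ?_⟩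
        intro x hx hxd
        rw [hGb, Real.dist_eq, sub_zero]
        rw [Real.dist_eq, sub_zero] at hxd
        rcases (show 0 ≤ x from hx).lt_or_eq with h0 | h0
        · rw [abs_of_pos h0] at hxd
          rw [abs_of_pos (div_pos (hFpos x h0) (hfpos x h0))]
          exact (Gmono x δ h0 hxd.le).trans_lt hGδ
        · rw [← h0, F0, zero_div, abs_zero]; exact hε
      · have h1 := (hcF β hb0).mono (Ici_subset_Ici.2 hb0)
        have h2 := (hf β hb0).mono (Ici_subset_Ici.2 hb0)
        exact h1.div h2 (h.2.2.2.1 β h.2.2.1).ne'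
  · intro s hs
    exact div_mul_cancel₀ _ (hfpos s hs).ne'

lemma inv_cont_s14 {u ρ : ℝ → ℝ} {x y : ℝ} {S : Set ℝ} (hu : ContinuousOn u (Icc x y))
    (hm : ∀ s ∈ S, ρ s ∈ Icc x y ∧ u (ρ s) = s) (hi : ∀ r ∈ Icc x y, ρ (u r) = r) :
    ContinuousOn ρ S := by
  rw [continuousOn_iff_isClosed]
  intro t ht
  refine ⟨u '' (Icc x y ∩ t), ?_, ?_⟩
  · exact ((isCompact_Icc.inter_right ht).image_of_continuousOn
      (hu.mono inter_subset_left)).isClosed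
  · ext s
    constructor
    · rintro ⟨h1, h2⟩
      exact ⟨⟨ρ s, ⟨(hm s h2).1, h1⟩, (hm s h2).2⟩, h2⟩
    · rintro ⟨⟨r, ⟨hr1, hr2⟩, rfl⟩, h2⟩
      refine ⟨?_, h2⟩
      rw [mem_preimage, hi r hr1]; exact hr2

lemma mkBr {m : ℕ} {f u u' ρ : ℝ → ℝ} {a b x y M : ℝ} (ha : 0 < a)
    (h : IsPosSolAnn (m+2) a b f u u') (hx : a ≤ x) (hy : y ≤ b)
    (hm : ∀ s ∈ Icc 0 M, ρ s ∈ Icc x y ∧ u (ρ s) = s) (hi : ∀ r ∈ Icc x y, ρ (u r) = r)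
    (hxe : u x ∉ Ioo 0 M) (hye : u y ∉ Ioo 0 M) (hne : ∀ r ∈ Ioo x y, u' r ≠ 0) :
    Br_s14 m f M ρ (fun s => u' (ρ s)) := by
  obtain ⟨h1, h2, h3, h4, h5, -⟩ := h
  have hsub : Icc x y ⊆ Icc a b := Icc_subset_Icc hx hy
  have hc := inv_cont_s14 (h1.mono hsub) hm hi
  have hin : ∀ s ∈ Ioo 0 M, ρ s ∈ Ioo x y := by
    intro s hs
    obtain ⟨k1, k2⟩ := hm s ⟨hs.1.le, hs.2.le⟩
    refine ⟨lt_of_le_of_ne k1.1 ?_, lt_of_le_of_ne k1.2 ?_⟩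
    · intro he; apply hxe; rw [he, k2]; exact hs
    · intro he; apply hye; rw [← he, k2]; exact hs
  have hin' : ∀ s ∈ Ioo 0 M, ρ s ∈ Ioo a b := fun s hs =>
    ⟨hx.trans_lt (hin s hs).1, (hin s hs).2.trans_le hy⟩
  have hdr : ∀ s ∈ Ioo 0 M, HasDerivAt ρ (u' (ρ s))⁻¹ s := by
    intro s hs
    have hn : Icc 0 M ∈ nhds s := Icc_mem_nhds hs.1 hs.2
    refine HasDerivAt.of_local_left_inverse (hc.continuousAt hn) (h4 _ (hin' s hs))
      (hne _ (hin s hs)) ?_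
    filter_upwards [hn] with t ht
    exact (hm t ht).2
  refine ⟨hc, ?_, ?_, ?_, hdr, ?_⟩
  · exact (h3.mono hsub).comp hc (fun s hs => (hm s hs).1)
  · intro s hs
    exact ha.trans_le (hx.trans (hm s hs).1.1)
  · intro s hs; exact hne _ (hin s hs)
  · intro s hs
    have := (h5 _ (hin' s hs)).comp s (hdr s hs)
    rw [(hm s ⟨hs.1.le, hs.2.le⟩).2] at this
    refine this.congr_deriv ?_
    push_cast
    ring

lemma sol_facts {m : ℕ} {f u u' rb G : ℝ → ℝ} {a b c M β : ℝ} (ha : 0 < a)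
    (hN : NL m f (Fint f) G β)
    (h : IsPosSolAnn (m+2) a b f u u') (hc : c ∈ Ioo a b)
    (hup : ∀ r ∈ Ico a c, 0 < u' r) (hdown : ∀ r ∈ Ioo c b, u' r < 0) (hM : M = u c)
    (hm : ∀ s ∈ Icc 0 M, rb s ∈ Icc c b ∧ u (rb s) = s) (hi : ∀ r ∈ Icc c b, rb (u r) = r) :
    ∃ rl : ℝ → ℝ, Br_s14 m f M rl (fun s => u' (rl s)) ∧ Br_s14 m f M rb (fun s => u' (rb s)) ∧ β < M ∧
      rl 0 = a ∧ rl M = c ∧ rb M = c ∧ u' c = 0 ∧ (∀ s ∈ Icc 0 M, 0 ≤ u' (rl s)) ∧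
      (∀ s ∈ Ioo 0 M, 0 < u' (rl s)) ∧ (∀ s ∈ Icc 0 M, u' (rb s) ≤ 0) ∧
      ∀ s ∈ Icc 0 M, 0 ≤ (u' (rl s))^2 + 2 * Fint f s := by
  obtain ⟨h1, h2, h3, h4, h5, ua, ub, upos⟩ := id h
  have hM0 : 0 < M := by rw [hM]; exact upos c hc
  have hab : a < b := hc.1.trans hc.2
  have F0 : Fint f 0 = 0 := by simp [Fint]
  have sgnL : ∀ r ∈ Icc a c, 0 ≤ u' r := by
    intro r hr
    have hcl : ContinuousWithinAt u' (Ico a c) r :=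
      (h3 r ⟨hr.1, hr.2.trans hc.2.le⟩).mono
        (Ico_subset_Icc_self.trans (Icc_subset_Icc_right hc.2.le))
    have hcl2 : r ∈ closure (Ico a c) := by rw [closure_Ico hc.1.ne]; exact hr
    have := hcl.mem_closure (t := Ici 0) hcl2 (fun t h => (hup t h).le)
    rwa [isClosed_Ici.closure_eq] at this
  have sgnR : ∀ r ∈ Icc c b, u' r ≤ 0 := by
    intro r hr
    have hcl : ContinuousWithinAt u' (Ioo c b) r :=
      (h3 r ⟨hc.1.le.trans hr.1, hr.2⟩).mono
        (Ioo_subset_Icc_self.trans (Icc_subset_Icc_left hc.1.le))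
    have hcl2 : r ∈ closure (Ioo c b) := by rw [closure_Ioo hc.2.ne]; exact hr
    have := hcl.mem_closure (t := Iic 0) hcl2 (fun t h => (hdown t h).le)
    rwa [isClosed_Iic.closure_eq] at this
  have uc : u' c = 0 := le_antisymm (sgnR c ⟨le_rfl, hc.2.le⟩) (sgnL c ⟨hc.1.le, le_rfl⟩)
  have unn : ∀ r ∈ Icc a b, 0 ≤ u r := by
    intro r hr
    rcases hr.1.lt_or_eq with h | h
    · rcases hr.2.lt_or_eq with h' | h'
      · exact (upos r ⟨h, h'⟩).le
      · rw [h', ub]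
    · rw [← h, ua]
  have cE : ContinuousOn (fun r => (u' r)^2 + 2 * Fint f (u r)) (Icc a b) := by
    have : ContinuousOn (fun r => Fint f (u r)) (Icc a b) := hN.cF.comp h1 unn
    fun_prop
  have dE : ∀ r ∈ Ioo a b, HasDerivAt (fun r => (u' r)^2 + 2 * Fint f (u r))
      (-(2 * (((m:ℝ)+1) / r * (u' r)^2))) r := by
    intro r hr
    have hF := ((hN.dF _ (upos r hr)).comp r (h4 r hr)).const_mul 2
    refine (((h5 r hr).fun_pow 2).fun_add hF).congr_deriv ?_
    push_cast
    ring
  have Epos : ∀ r ∈ Icc a b, 0 ≤ (u' r)^2 + 2 * Fint f (u r) := by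
    intro r hr
    have := anti_help hr.2 (cE.mono (Icc_subset_Icc_left hr.1)) (by
      intro t ht
      have ht' : t ∈ Ioo a b := ⟨hr.1.trans_lt ht.1, ht.2⟩
      refine ⟨_, ?_, dE t ht'⟩
      have : 0 < t := ha.trans ht'.1
      have : 0 ≤ ((m:ℝ)+1) / t * (u' t)^2 := by positivity
      linarith)
    simp only [ub, F0] at this
    nlinarith [sq_nonneg (u' b)]
  have hbM : β < M := by
    have := smono_help (g := fun r => -((u' r)^2 + 2 * Fint f (u r))) hc.2
      (cE.mono (Icc_subset_Icc_left hc.1.le)).neg (by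
      intro t ht
      have ht' : t ∈ Ioo a b := ⟨hc.1.trans ht.1, ht.2⟩
      refine ⟨_, ?_, (dE t ht').neg⟩
      have : 0 < t := ha.trans ht'.1
      have : u' t ≠ 0 := (hdown t ht).ne
      have : 0 < ((m:ℝ)+1) / t * (u' t)^2 := by positivity
      linarith)
    simp only [ub, F0, uc, ← hM] at this
    by_contra hcon
    push Not at hcon
    have := hN.Fneg M ⟨hM0.le, hcon⟩
    nlinarith [sq_nonneg (u' b)]
  have smon : StrictMonoOn u (Icc a c) := by
    intro x hx y hy hxy
    refine smono_help hxy (h1.mono (Icc_subset_Icc hx.1 (hy.2.trans hc.2.le))) ?_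
    intro t ht
    exact ⟨u' t, hup t ⟨hx.1.trans ht.1.le, ht.2.trans_le hy.2⟩,
      h4 t ⟨hx.1.trans_lt ht.1, ht.2.trans_le (hy.2.trans hc.2.le)⟩⟩
  have hex : ∀ s ∈ Icc 0 M, ∃ r, r ∈ Icc a c ∧ u r = s := by
    intro s hs
    have := intermediate_value_Icc hc.1.le (h1.mono (Icc_subset_Icc_right hc.2.le))
    rw [ua, ← hM] at this
    obtain ⟨r, hr, hr'⟩ := this hs
    exact ⟨r, hr, hr'⟩
  choose! rl hrl using hex
  have uran : ∀ r ∈ Icc a c, u r ∈ Icc 0 M := by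
    intro r hr
    refine ⟨unn r ⟨hr.1, hr.2.trans hc.2.le⟩, ?_⟩
    rw [hM]
    exact smon.monotoneOn hr ⟨hc.1.le, le_rfl⟩ hr.2
  have hrli : ∀ r ∈ Icc a c, rl (u r) = r := by
    intro r hr
    obtain ⟨k1, k2⟩ := hrl (u r) (uran r hr)
    exact smon.injOn k1 hr k2
  have BL : Br_s14 m f M rl (fun s => u' (rl s)) :=
    mkBr ha h le_rfl hc.2.le hrl hrli (by simp [ua]) (by simp [← hM])
      (fun r hr => (hup r ⟨hr.1.le, hr.2⟩).ne')
  have BR : Br_s14 m f M rb (fun s => u' (rb s)) :=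
    mkBr ha h hc.1.le le_rfl hm hi (by simp [← hM]) (by simp [ub])
      (fun r hr => (hdown r hr).ne)
  have nnL : ∀ s ∈ Icc 0 M, 0 ≤ u' (rl s) := fun s hs => sgnL _ (hrl s hs).1
  refine ⟨rl, BL, BR, hbM, ?_, ?_, ?_, uc, nnL, ?_, ?_, ?_⟩
  · have := hrli a ⟨le_rfl, hc.1.le⟩
    rwa [ua] at this
  · have := hrli c ⟨hc.1.le, le_rfl⟩
    rwa [← hM] at this
  · have := hi c ⟨le_rfl, hc.2.le⟩
    rwa [← hM] at this
  · intro s hs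
    exact lt_of_le_of_ne (nnL s ⟨hs.1.le, hs.2.le⟩) (BL.ne s hs).symm
  · intro s hs
    exact sgnR _ (hm s hs).1
  · intro s hs
    obtain ⟨k1, k2⟩ := hrl s hs
    have := Epos (rl s) ⟨k1.1, k1.2.trans hc.2.le⟩
    rwa [k2] at this

/-- Step five (Proposition 3.6): if either (i) `r̄₁(M₁) < r̄₂(M₁)` and `r̄₁, r̄₂`
intersect in `(β, M₁)`, or (ii) `r̄₁(M₁) ≥ r̄₂(M₁)`, then `r̄₁(β) > r̄₂(β)` and
`r̄₁(β) u₁'(r̄₁(β)) > r̄₂(β) u₂'(r̄₂(β))`. -/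
theorem step_five
    (n : ℕ) (hn : 2 ≤ n) (f : ℝ → ℝ) (β B : ℝ)
    (hf1 : CondF1 f) (hf2 : CondF2 f β B) (hf3 : CondF3 n f β)
    (a b : ℝ) (ha : 0 < a) (hab : a < b)
    (u₁ u₁' u₂ u₂' : ℝ → ℝ)
    (h₁ : IsPosSolAnn n a b f u₁ u₁') (h₂ : IsPosSolAnn n a b f u₂ u₂')
    (hslope₁ : 0 < u₁' a) (hslope₁₂ : u₁' a < u₂' a)
    (c₁ c₂ : ℝ) (hc₁ : c₁ ∈ Ioo a b) (hc₂ : c₂ ∈ Ioo a b)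
    (hc₁up : ∀ r ∈ Ico a c₁, 0 < u₁' r) (hc₁down : ∀ r ∈ Ioo c₁ b, u₁' r < 0)
    (hc₂up : ∀ r ∈ Ico a c₂, 0 < u₂' r) (hc₂down : ∀ r ∈ Ioo c₂ b, u₂' r < 0)
    (M₁ M₂ : ℝ) (hM₁ : M₁ = u₁ c₁) (hM₂ : M₂ = u₂ c₂)
    (rb₁ rb₂ : ℝ → ℝ)
    (hrb₁mem : ∀ s ∈ Icc (0:ℝ) M₁, rb₁ s ∈ Icc c₁ b ∧ u₁ (rb₁ s) = s)
    (hrb₁inv : ∀ r ∈ Icc c₁ b, rb₁ (u₁ r) = r)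
    (hrb₂mem : ∀ s ∈ Icc (0:ℝ) M₂, rb₂ s ∈ Icc c₂ b ∧ u₂ (rb₂ s) = s)
    (hrb₂inv : ∀ r ∈ Icc c₂ b, rb₂ (u₂ r) = r)
    (hcase : (rb₁ M₁ < rb₂ M₁ ∧ ∃ s ∈ Ioo β M₁, rb₁ s = rb₂ s) ∨ rb₂ M₁ ≤ rb₁ M₁) :
    rb₂ β < rb₁ β ∧ rb₂ β * u₂' (rb₂ β) < rb₁ β * u₁' (rb₁ β) := by
  obtain ⟨m, rfl⟩ := Nat.exists_eq_add_of_le' hn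
  have hN := mkNL hf1 hf2 hf3
  obtain ⟨l₁, L₁, R₁, hb1, l10, l1M, r1M, uc1, nn1, pos1, np1, E1⟩ :=
    sol_facts ha hN h₁ hc₁ hc₁up hc₁down hM₁ hrb₁mem hrb₁inv
  obtain ⟨l₂, L₂, R₂, hb2, l20, l2M, r2M, uc2, nn2, pos2, np2, E2⟩ :=
    sol_facts ha hN h₂ hc₂ hc₂up hc₂down hM₂ hrb₂mem hrb₂inv
  have hM10 : 0 < M₁ := hN.b0.trans_lt hb1
  have hM20 : 0 < M₂ := hN.b0.trans_lt hb2
  obtain ⟨hA, hB⟩ := left_lemma (M := min M₁ M₂) hN L₁ L₂ (min_le_left _ _) (min_le_right _ _)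
    (le_min hb1.le hb2.le) (by rw [l10, l20]) (by simpa only [l10] using hslope₁)
    (by simpa only [l10, l20] using hslope₁₂) pos1 pos2 nn2 E1
  have hM : M₁ < M₂ := by
    by_contra hcon
    push Not at hcon
    rw [min_eq_right hcon] at hA
    have h1 := (hA M₂ ⟨hM20.le, le_rfl⟩).1
    have h2 := nn1 M₂ ⟨hM20.le, hcon⟩
    simp only [l2M, uc2] at h1
    linarith
  rw [min_eq_left hM.le] at hA hB
  have hPL := leftP hN L₁ L₂ hM.le hb1.le nn1 nn2 (fun s hs => (hA s hs).2) hB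
  have top1 : PP m (Fint f) (fun t => Fint f t / f t) l₁ (fun s => u₁' (l₁ s)) M₁ =
      PP m (Fint f) (fun t => Fint f t / f t) rb₁ (fun s => u₁' (rb₁ s)) M₁ := by
    simp only [PP, l1M, r1M]
  have top2 : PP m (Fint f) (fun t => Fint f t / f t) l₂ (fun s => u₂' (l₂ s)) M₂ =
      PP m (Fint f) (fun t => Fint f t / f t) rb₂ (fun s => u₂' (rb₂ s)) M₂ := by
    simp only [PP, l2M, r2M]
  have hP2 : ∀ s ∈ Icc β M₂,
      PP m (Fint f) (fun t => Fint f t / f t) rb₂ (fun s => u₂' (rb₂ s)) s ≤ 0 := by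
    intro s hs
    have a1 := (Pside hN R₂ hs.1 hs.2 le_rfl).2 np2
    have a2 := (Pside hN L₂ le_rfl hb2.le le_rfl).1 nn2
    have a3 : PP m (Fint f) (fun t => Fint f t / f t) l₂ (fun s => u₂' (l₂ s)) β ≤ 0 := by
      have q := L₂.pos β ⟨hN.b0, hb2.le⟩
      simp only [PP, hN.Fb, zero_div]
      have : 0 ≤ (l₂ β)^(m+2) * (u₂' (l₂ β))^2 := by positivity
      linarith
    linarith
  have hP : PP m (Fint f) (fun t => Fint f t / f t) rb₂ (fun s => u₂' (rb₂ s)) M₁ <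
      PP m (Fint f) (fun t => Fint f t / f t) rb₁ (fun s => u₁' (rb₁ s)) M₁ := by
    have a1 := (Pside hN R₂ hb1.le hM.le le_rfl).2 np2
    have a2 := (Pside hN L₂ hb1.le hM.le le_rfl).1 nn2
    linarith
  exact right_start hN R₁ R₂ hM hb1 np1 np2 (by simp only [r1M, uc1]) hP2 hP hcase
end
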